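/- Let d ≥ 2 and let p,q > d/2 satisfy 1/p + 1/q < 2/d. For all ε > 0, T ≥ 1 and ω ∈ Ω_{p,q}, there exists ĉ₁ = ĉ₁(ε,T,ω) ∈ (0,∞) such that for all δ > 0 and all n > 1/δ, P_ω^0( osc_{B^{(n)}}([0,T],δ) > ε and H_{Λ_{√n/ε}} > 3Tn ) ≤ ĉ₁ √δ. -/

import Mathlib

open MeasureTheory Filter Topology Matrix
open scoped ENNReal NNReal

noncomputable section

namespace DetCond

/-- Vertices of `ℤ^d`. -/
abbrev Vert (d : ℕ) := Fin d → ℤ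

/-- Index of the (unordered) nearest-neighbour edge `(x, x + e i)` of `ℤ^d`;
the set of these indices is in natural bijection with `E(ℤ^d)` modulo orientation. -/
abbrev EdgeIx (d : ℕ) := Vert d × Fin d

/-- The space `Ω = (0,∞)^{E(ℤ^d)}` of (symmetric) conductance configurations, with
its product topology and product σ-algebra. -/
abbrev EnvSp (d : ℕ) := {ω : EdgeIx d → ℝ // ∀ e, 0 < ω e}

/-- The `i`-th coordinate unit vector of `ℤ^d`. -/
def unitv (d : ℕ) (i : Fin d) : Vert d := fun j => if j = i then 1 else 0

/-- The translation `τ_x` acting on environments: `c_{τ_x ω}(y,z) = c_ω(y+x,z+x)`. -/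
def shift (d : ℕ) (x : Vert d) (ω : EnvSp d) : EnvSp d :=
  ⟨fun e => ω.1 (e.1 + x, e.2), fun e => ω.2 (e.1 + x, e.2)⟩

/-- The conductance `c_ω(x,y)`; it vanishes when `x,y` are not nearest neighbours
and is symmetric in `x,y` by construction. -/
def cnd (d : ℕ) (ω : EnvSp d) (x y : Vert d) : ℝ :=
  ∑ i, ((if y = x + unitv d i then ω.1 (x, i) else 0) +
        (if x = y + unitv d i then ω.1 (y, i) else 0))

/-- `π_ω(x) = Σ_{z : (x,z) ∈ E(ℤ^d)} c_ω(x,z)`. -/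
def piOf (d : ℕ) (ω : EnvSp d) (x : Vert d) : ℝ :=
  ∑ i, (ω.1 (x, i) + ω.1 (x - unitv d i, i))

/-- The box `Λ_r = [-r,r]^d ∩ ℤ^d`. -/
def box (d : ℕ) (r : ℝ) : Finset (Vert d) :=
  Fintype.piFinset fun _ : Fin d => Finset.Icc ⌈-r⌉ ⌊r⌋

/-- The nearest neighbours of `x` in `ℤ^d`. -/
def nbrs (d : ℕ) (x : Vert d) : Finset (Vert d) :=
  (Finset.univ.image fun i => x + unitv d i) ∪ (Finset.univ.image fun i => x - unitv d i)

/-- The set `E(Λ)` of edges incident with at least one vertex of `Λ`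
(one index per unordered edge). -/
def edgesIn (d : ℕ) (Λ : Finset (Vert d)) : Finset (EdgeIx d) :=
  Λ.biUnion fun x =>
    (Finset.univ.image fun i => (x, i)) ∪ (Finset.univ.image fun i => (x - unitv d i, i))

/-- Bounded functions on `Ω`. -/
def IsBdd (d : ℕ) (f : EnvSp d → ℝ) : Prop := ∃ M, ∀ ω, |f ω| ≤ M

/-- Local functions: `f` depends only on the coordinates in some finite set `B` of edges
and, viewed as a function of those coordinates, has compact support in `(0,∞)^B`. -/
def IsLocalFn (d : ℕ) (f : EnvSp d → ℝ) : Prop :=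
  ∃ B : Finset (EdgeIx d),
    (∀ ω₁ ω₂ : EnvSp d, (∀ e ∈ B, ω₁.1 e = ω₂.1 e) → f ω₁ = f ω₂) ∧
    ∃ a b : ℝ, 0 < a ∧ ∀ ω : EnvSp d, (∃ e ∈ B, ω.1 e < a ∨ b < ω.1 e) → f ω = 0

/-- `ℓ_ω(f) = L`, i.e. the block averages of the translates of `f` converge to `L`. -/
def avgTo (d : ℕ) (ω : EnvSp d) (f : EnvSp d → ℝ) (L : ℝ) : Prop :=
  Tendsto (fun n : ℕ => (∑ x ∈ box d (n : ℝ), f (shift d x ω)) / ((box d (n : ℝ)).card : ℝ))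
    atTop (𝓝 L)

/-- `ω` is averaging: `ℓ_ω(f)` exists for every continuous local `f`. -/
def Averaging (d : ℕ) (ω : EnvSp d) : Prop :=
  ∀ f : EnvSp d → ℝ, Continuous f → IsLocalFn d f → ∃ L, avgTo d ω f L

/-- `ω` is tempered, i.e. `ω ∈ Ω'`. -/
def Tempered (d : ℕ) (ω : EnvSp d) : Prop :=
  Tendsto (fun ε : ℝ =>
      limsup (fun n : ℕ =>
        (∑ e ∈ edgesIn d (box d (n : ℝ)),
            (if ε ≤ ω.1 e ∧ ω.1 e ≤ ε⁻¹ then (0:ℝ) else 1)) / (n : ℝ) ^ d) atTop)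
    (𝓝[>] 0) (𝓝 0)

/-- `P` is the measure `ℙ_ω` associated with an averaging tempered `ω`:
the unique probability measure whose expectation of every bounded continuous function
is the corresponding block-average limit `ℓ_ω(f)`. -/
def IsEnvLaw (d : ℕ) (ω : EnvSp d) (P : Measure (EnvSp d)) : Prop :=
  IsProbabilityMeasure P ∧
    ∀ f : EnvSp d → ℝ, Continuous f → IsBdd d f → avgTo d ω f (∫ ω', f ω' ∂P)

/-- Ergodicity of a measure on `Ω` with respect to the translations of `ℤ^d`. -/
def ErgodicEnv (d : ℕ) (P : Measure (EnvSp d)) : Prop :=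
  ∀ A : Set (EnvSp d), MeasurableSet A → (∀ x : Vert d, shift d x ⁻¹' A = A) →
    P A = 0 ∨ P A = 1

/-- `ω ∈ Ω⋆`: tempered, averaging, and the associated measure `ℙ_ω` is ergodic. -/
def InOmegaStar (d : ℕ) (ω : EnvSp d) : Prop :=
  Tempered d ω ∧ Averaging d ω ∧
    ∀ P : Measure (EnvSp d), IsEnvLaw d ω P → ErgodicEnv d P

/-- `ω ∈ Ω_{p,q}`. -/
def InOmegaPQ (d : ℕ) (p q : ℝ) (ω : EnvSp d) : Prop :=
  (∃ C : ℝ, ∀ n : ℕ, 1 ≤ n →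
      (∑ e ∈ edgesIn d (box d (n : ℝ)), ω.1 e ^ p) / (n : ℝ) ^ d ≤ C) ∧
  (∃ C : ℝ, ∀ n : ℕ, 1 ≤ n →
      (∑ e ∈ edgesIn d (box d (n : ℝ)), ω.1 e ^ (-q)) / (n : ℝ) ^ d ≤ C)

/-- The path space of the discrete-time walk. -/
abbrev Path (d : ℕ) := ℕ → Vert d

/-- One-step transition probabilities `𝖯_ω(x,y) = c_ω(x,y)/π_ω(x)`. -/
def transP (d : ℕ) (ω : EnvSp d) (x y : Vert d) : ℝ := cnd d ω x y / piOf d ω x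

/-- `μ` is the law `P_ω^{x₀}` of the random walk among the conductances `ω`
started at `x₀`: a probability measure on the path space with the prescribed
finite-dimensional (cylinder) probabilities. -/
def IsWalkLaw (d : ℕ) (ω : EnvSp d) (x₀ : Vert d) (μ : Measure (Path d)) : Prop :=
  IsProbabilityMeasure μ ∧
    ∀ (n : ℕ) (γ : ℕ → Vert d),
      μ {w | ∀ k ≤ n, w k = γ k} =
        (if γ 0 = x₀ then 1 else 0) *
          ∏ k ∈ Finset.range n, ENNReal.ofReal (transP d ω (γ k) (γ (k+1)))

/-- `n`-step transition probabilities of the discrete-time walk. -/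
def stepP (d : ℕ) (ω : EnvSp d) : ℕ → Vert d → Vert d → ℝ
  | 0, x, y => if x = y then 1 else 0
  | n+1, x, y => ∑ z ∈ nbrs d x, transP d ω x z * stepP d ω n z y

/-- `P_ω^x(Y_t = y)` for the constant-speed continuous-time walk `Y_t = X_{N(t)}`,
where `N` is an independent rate-1 Poisson process. -/
def ctP (d : ℕ) (ω : EnvSp d) (t : ℝ) (x y : Vert d) : ℝ :=
  ∑' k : ℕ, Real.exp (-t) * t ^ k / (Nat.factorial k : ℝ) * stepP d ω k x y

/-- The `ℓ¹`-norm of a vertex of `ℤ^d`. -/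
def l1 (d : ℕ) (x : Vert d) : ℝ := ∑ i, |(x i : ℝ)|

/-- A vertex of `ℤ^d` regarded as a point of `ℝ^d`. -/
def ivert (d : ℕ) (x : Vert d) : Fin d → ℝ := fun i => (x i : ℝ)

/-- The linearly interpolated diffusively rescaled walk `B^{(n)}`. -/
def BnProc (d : ℕ) (n : ℕ) (w : Path d) (t : ℝ) : Fin d → ℝ :=
  (Real.sqrt n)⁻¹ •
    (ivert d (w ⌊t * n⌋₊) +
      (t * n - (⌊t * n⌋₊ : ℝ)) • (ivert d (w (⌊t * n⌋₊ + 1)) - ivert d (w ⌊t * n⌋₊)))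


/-- The measure `ℚ_ω` obtained from `ℙ_ω` by tilting with `π(0)`. -/
def Qmeas (d : ℕ) (P : Measure (EnvSp d)) : Measure (EnvSp d) :=
  P.withDensity fun ω' => ENNReal.ofReal (piOf d ω' 0 / ∫ ω'', piOf d ω'' 0 ∂P)

/-- The inner product `⟨f,g⟩_{L²(πμ)}`. -/
def innerP (d : ℕ) (P : Measure (EnvSp d)) (f g : EnvSp d → ℝ) : ℝ :=
  ∫ ω', f ω' * g ω' * piOf d ω' 0 ∂P

/-- The Dirichlet pairing `⟨h, (−L)h⟩_{L²(πμ)}`. -/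
def quadL (d : ℕ) (P : Measure (EnvSp d)) (h : EnvSp d → ℝ) : ℝ :=
  ∫ ω', (∑ z ∈ nbrs d 0, cnd d ω' 0 z * (h ω' - h (shift d z ω'))) * h ω' ∂P

/-- The inner product of `L²(ν)`. -/
def innerQ (d : ℕ) (ν : Measure (EnvSp d)) (f g : EnvSp d → ℝ) : ℝ :=
  ∫ ω', f ω' * g ω' ∂ν

/-- The Dirichlet pairing `⟨h, (−L)h⟩_{L²(ν)}`. -/
def quadQ (d : ℕ) (ν : Measure (EnvSp d)) (h : EnvSp d → ℝ) : ℝ :=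
  ∫ ω', ((piOf d ω' 0)⁻¹ *
      ∑ z ∈ nbrs d 0, cnd d ω' 0 z * (h ω' - h (shift d z ω'))) * h ω' ∂ν

/-- The set whose supremum is the variational characterization
`⟨f,(−L)⁻¹f⟩_{L²(ν)} = sup_h [2⟨h,f⟩ − ⟨h,(−L)h⟩]` (over bounded continuous `h`);
`⟨f,(−L)⁻¹f⟩_{L²(ν)} < ∞` means this set is bounded above. -/
def invPairSet (d : ℕ) (ν : Measure (EnvSp d)) (f : EnvSp d → ℝ) : Set ℝ :=
  {r | ∃ h : EnvSp d → ℝ, Continuous h ∧ IsBdd d h ∧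
        r = 2 * innerQ d ν h f - quadQ d ν h}

/-- The function `f(ω) = π_ω(0)⁻¹ ∇⋆(c v)(ω)` built from a vector field `v`. -/
def fDiv (d : ℕ) (v : EnvSp d → Fin d → ℝ) (ω : EnvSp d) : ℝ :=
  (piOf d ω 0)⁻¹ *
    ∑ i, (cnd d ω 0 (unitv d i) * v ω i -
          cnd d ω (-(unitv d i)) 0 * v (shift d (-(unitv d i)) ω) i)

/-- The inner product of `ℓ²(Λ,π_ω)`. -/
def innerF (d : ℕ) (ω : EnvSp d) (Λ : Finset (Vert d)) (f g : Vert d → ℝ) : ℝ :=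
  ∑ x ∈ Λ, f x * g x * piOf d ω x

/-- The pairing `⟨h, (−𝖫_ω)h⟩_{ℓ²(Λ,π_ω)}` for `h` vanishing outside `Λ`. -/
def quadF (d : ℕ) (ω : EnvSp d) (Λ : Finset (Vert d)) (h : Vert d → ℝ) : ℝ :=
  ∑ x ∈ Λ, (∑ z ∈ nbrs d x, cnd d ω x z * (h x - h z)) * h x

/-- `⟨f, (−𝖫_ω)⁻¹_Λ f⟩_{ℓ²(Λ,π_ω)}` via its variational characterization
`sup_h [2⟨h,f⟩ − ⟨h,(−𝖫_ω)h⟩]` over `h ∈ ℓ²(Λ,π_ω)`. -/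
def invPairF (d : ℕ) (ω : EnvSp d) (Λ : Finset (Vert d)) (f : Vert d → ℝ) : ℝ :=
  sSup {r | ∃ h : Vert d → ℝ, (∀ x ∉ Λ, h x = 0) ∧
      r = 2 * innerF d ω Λ h f - quadF d ω Λ h}

/-- The antisymmetric edge function `v∘τ(ω)`: the value assigned to the
edge `(x, x+e_i)` is `v_i(τ_x(ω))`. -/
def efield (d : ℕ) (v : EnvSp d → Fin d → ℝ) (ω : EnvSp d) : Vert d → Fin d → ℝ :=
  fun x i => v (shift d x ω) i

/-- The discrete gradient `∇h` of `h : ℤ^d → ℝ` as an edge function. -/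
def dgradE (d : ℕ) (h : Vert d → ℝ) : Vert d → Fin d → ℝ :=
  fun x i => h (x + unitv d i) - h x

/-- The inner product `⟨u,w⟩_{ℓ²(E(Λ), c_ω)}` of (antisymmetric) edge functions;
each unordered edge is counted once, which agrees with the paper's sum over
ordered edges carrying the factor ½. -/
def einner (d : ℕ) (ω : EnvSp d) (Λ : Finset (Vert d)) (u w : Vert d → Fin d → ℝ) : ℝ :=
  ∑ e ∈ edgesIn d Λ, u e.1 e.2 * w e.1 e.2 * ω.1 e

/-- The Dirichlet energy `𝓔_Λ^ω(v)`. -/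
def direnergy (d : ℕ) (ω : EnvSp d) (Λ : Finset (Vert d)) (v : EnvSp d → Fin d → ℝ) : ℝ :=
  sInf {r | ∃ h : Vert d → ℝ, (∀ x ∉ Λ, h x = 0) ∧
      r = einner d ω Λ (fun x i => efield d v ω x i - dgradE d h x i)
            (fun x i => efield d v ω x i - dgradE d h x i)}

/-- The gradient `∇h` of a function on `Ω`. -/
def gradOmega (d : ℕ) (h : EnvSp d → ℝ) : EnvSp d → Fin d → ℝ :=
  fun ω i => h (shift d (unitv d i) ω) - h ω

/-- The inner product `⟨u, c w⟩_{L²(P,ℝ^d)}`. -/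
def cinnerP (d : ℕ) (P : Measure (EnvSp d)) (u w : EnvSp d → Fin d → ℝ) : ℝ :=
  ∑ i, ∫ ω', cnd d ω' 0 (unitv d i) * u ω' i * w ω' i ∂P

/-- Bounded vector fields on `Ω`. -/
def IsBddV (d : ℕ) (v : EnvSp d → Fin d → ℝ) : Prop := ∃ M, ∀ ω i, |v ω i| ≤ M

/-- The space `𝒱 = (ℝ^d)^{ℤ^d}` of vector fields on `ℤ^d`. -/
abbrev VS (d : ℕ) := Vert d → Fin d → ℝ

/-- The empirical measures `μ_r^{ω,v}` built from the minimizers `h_r` of the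
finite-volume Dirichlet energies. -/
def muR (d : ℕ) (ω : EnvSp d) (hr : ℕ → Vert d → ℝ) (r : ℕ) :
    Measure (EnvSp d × VS d) :=
  (((box d ((r : ℝ) + Real.sqrt r)).card : ℝ≥0∞) *
      ((box d (Real.sqrt r)).card : ℝ≥0∞))⁻¹ •
    ∑ z ∈ box d (Real.sqrt r), ∑ x ∈ box d ((r : ℝ) + Real.sqrt r),
      Measure.dirac (shift d (x + z) ω, fun y => dgradE d (hr r) (x + z + y))

/-- The localized conductances `c_ω^R`. -/
def cR (d : ℕ) (ω : EnvSp d) (R : ℝ) (e : EdgeIx d) : ℝ :=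
  if e ∈ edgesIn d (box d (2 * R)) then ω.1 e else 1

/-- The localized measure `π_ω^R`. -/
def piRloc (d : ℕ) (ω : EnvSp d) (R : ℝ) (x : Vert d) : ℝ :=
  if x ∈ box d (2 * R) then piOf d ω x
  else if x ∈ box d (4 * R) then 1 + piOf d ω x else 1

/-- The localized Dirichlet form `D_ω^R(f,f)` (each unordered edge counted once). -/
def DR (d : ℕ) (ω : EnvSp d) (R : ℝ) (f : Vert d → ℝ) : ℝ≥0∞ :=
  ∑' e : EdgeIx d, ENNReal.ofReal (cR d ω R e * (f (e.1 + unitv d e.2) - f e.1) ^ 2)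

/-- The norm `‖f‖_{ℓ^s(μ)}`. -/
def lpN (d : ℕ) (μw : Vert d → ℝ) (s : ℝ) (f : Vert d → ℝ) : ℝ≥0∞ :=
  (∑' x : Vert d, ENNReal.ofReal (|f x| ^ s * μw x)) ^ (1 / s)

/-- The exponent `ε = 2(2/d − 1/p − 1/q)((d−2)/d + 1/q)⁻¹`. -/
def epsPQ (d : ℕ) (p q : ℝ) : ℝ :=
  2 * (2 / (d : ℝ) - 1 / p - 1 / q) / (((d : ℝ) - 2) / (d : ℝ) + 1 / q)

/-- Jump rates of the localized constant-speed chain `Y^R`: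
rate `c_ω^R(x,y)/π_ω^R(x)` from `x` to `y`. -/
def rateR (d : ℕ) (ω : EnvSp d) (R : ℝ) (x y : Vert d) : ℝ :=
  (∑ i, ((if y = x + unitv d i then cR d ω R (x, i) else 0) +
         (if x = y + unitv d i then cR d ω R (y, i) else 0))) / piRloc d ω R x

/-- The generator matrix of `Y^R`. -/
def qmatR (d : ℕ) (ω : EnvSp d) (R : ℝ) (x y : Vert d) : ℝ :=
  if x = y then -(∑ z ∈ nbrs d x, rateR d ω R x z) else rateR d ω R x y

/-- Iterates of the generator matrix of `Y^R`. -/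
def qiter (d : ℕ) (ω : EnvSp d) (R : ℝ) : ℕ → Vert d → Vert d → ℝ
  | 0, x, y => if x = y then 1 else 0
  | n+1, x, y => ∑ z ∈ insert x (nbrs d x), qmatR d ω R x z * qiter d ω R n z y

/-- The heat kernel `P_ω^x(Y_t^R = y) = (e^{tQ})(x,y)` of the localized chain `Y^R`. -/
def hkR (d : ℕ) (ω : EnvSp d) (R : ℝ) (t : ℝ) (x y : Vert d) : ℝ :=
  ∑' k : ℕ, t ^ k / (Nat.factorial k : ℝ) * qiter d ω R k x y

/-! ### Killed reversible chains on a finite set -/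

/-- A symmetric nonnegative weight `c` whose row sums are dominated by `w`. -/
structure IsNetwork {V : Type*} (w : V → ℝ) (c : V → V → ℝ) : Prop where
  pos : ∀ x, 0 < w x
  nonneg : ∀ x y, 0 ≤ c x y
  symm : ∀ x y, c x y = c y x
  sum_le : ∀ (S : Finset V) (x : V), ∑ y ∈ S, c x y ≤ w x

/-- The transition operator of the chain with transition probabilities `c x y / w x`,
killed upon leaving `S`. -/
def killedOp {V : Type*} (w : V → ℝ) (c : V → V → ℝ) (S : Finset V) :
    Module.End ℝ (V → ℝ) where
  toFun f x := ∑ y ∈ S, c x y / w x * f y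
  map_add' f g := by
    funext x
    simp [mul_add, Finset.sum_add_distrib]
  map_smul' a f := by
    funext x
    simp only [Pi.smul_apply, smul_eq_mul, RingHom.id_apply, Finset.mul_sum]
    exact Finset.sum_congr rfl fun y _ => by ring

/-- The inner product of `ℓ²(S, w)`. -/
def wInner {V : Type*} (w : V → ℝ) (S : Finset V) (f g : V → ℝ) : ℝ :=
  ∑ x ∈ S, w x * f x * g x

section Killed

variable {V : Type*} {w : V → ℝ} {c : V → V → ℝ} (S : Finset V)

theorem killedOp_apply (f : V → ℝ) (x : V) :
    killedOp w c S f x = ∑ y ∈ S, c x y / w x * f y := rfl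

theorem wInner_comm (f g : V → ℝ) : wInner w S f g = wInner w S g f :=
  Finset.sum_congr rfl fun x _ => by ring

theorem wInner_add_left (f g h : V → ℝ) :
    wInner w S (f + g) h = wInner w S f h + wInner w S g h := by
  simp only [wInner, Pi.add_apply, ← Finset.sum_add_distrib]
  exact Finset.sum_congr rfl fun x _ => by ring

theorem wInner_sub_left (f g h : V → ℝ) :
    wInner w S (f - g) h = wInner w S f h - wInner w S g h := by
  simp only [wInner, Pi.sub_apply, ← Finset.sum_sub_distrib]
  exact Finset.sum_congr rfl fun x _ => by ring

theorem wInner_add_right (f g h : V → ℝ) :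
    wInner w S f (g + h) = wInner w S f g + wInner w S f h := by
  simp only [wInner_comm S f, wInner_add_left]

theorem wInner_sub_right (f g h : V → ℝ) :
    wInner w S f (g - h) = wInner w S f g - wInner w S f h := by
  simp only [wInner_comm S f, wInner_sub_left]

theorem wInner_self_nonneg (H : IsNetwork w c) (f : V → ℝ) : 0 ≤ wInner w S f f :=
  Finset.sum_nonneg fun x _ => by
    rw [mul_assoc]
    exact mul_nonneg (H.pos x).le (mul_self_nonneg _)

theorem wInner_killedOp_left (H : IsNetwork w c) (f g : V → ℝ) :
    wInner w S (killedOp w c S f) g = ∑ x ∈ S, ∑ y ∈ S, c x y * f y * g x := by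
  refine Finset.sum_congr rfl fun x _ => ?_
  rw [killedOp_apply, Finset.mul_sum, Finset.sum_mul]
  refine Finset.sum_congr rfl fun y _ => ?_
  have := (H.pos x).ne'
  field_simp

theorem wInner_killedOp_symm (H : IsNetwork w c) (f g : V → ℝ) :
    wInner w S (killedOp w c S f) g = wInner w S f (killedOp w c S g) := by
  rw [wInner_comm S f, wInner_killedOp_left S H, wInner_killedOp_left S H, Finset.sum_comm]
  refine Finset.sum_congr rfl fun x _ => Finset.sum_congr rfl fun y _ => ?_
  rw [H.symm y x]
  ring

theorem abs_wInner_killedOp_le (H : IsNetwork w c) (f : V → ℝ) :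
    |wInner w S (killedOp w c S f) f| ≤ wInner w S f f := by
  rw [wInner_killedOp_left S H]
  have h1 : ∑ x ∈ S, ∑ y ∈ S, c x y * (f x ^ 2) ≤ wInner w S f f := by
    refine Finset.sum_le_sum fun x _ => ?_
    rw [← Finset.sum_mul]
    have := mul_le_mul_of_nonneg_right (H.sum_le S x) (sq_nonneg (f x))
    nlinarith
  have h2 : ∑ x ∈ S, ∑ y ∈ S, c x y * (f y ^ 2) = ∑ x ∈ S, ∑ y ∈ S, c x y * (f x ^ 2) := by
    rw [Finset.sum_comm]
    refine Finset.sum_congr rfl fun x _ => Finset.sum_congr rfl fun y _ => ?_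
    rw [H.symm y x]
  have h3 : |∑ x ∈ S, ∑ y ∈ S, c x y * f y * f x| ≤
      ∑ x ∈ S, ∑ y ∈ S, (c x y * (f x ^ 2) / 2 + c x y * (f y ^ 2) / 2) := by
    refine (Finset.abs_sum_le_sum_abs _ _).trans (Finset.sum_le_sum fun x _ => ?_)
    refine (Finset.abs_sum_le_sum_abs _ _).trans (Finset.sum_le_sum fun y _ => ?_)
    rw [mul_assoc, abs_mul, abs_of_nonneg (H.nonneg x y)]
    have : |f y * f x| ≤ (f x ^ 2 + f y ^ 2) / 2 :=
      abs_le.2 ⟨by nlinarith [sq_nonneg (f x + f y)], by nlinarith [sq_nonneg (f x - f y)]⟩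
    calc c x y * |f y * f x| ≤ c x y * ((f x ^ 2 + f y ^ 2) / 2) :=
          mul_le_mul_of_nonneg_left this (H.nonneg x y)
      _ = _ := by ring
  simp only [Finset.sum_add_distrib, ← Finset.sum_div] at h3
  linarith

/-- `2 (‖f‖² - ‖Q f‖²)` splits into the Dirichlet form of `f + Q f` and a nonnegative term. -/
theorem dirichlet_add_le (H : IsNetwork w c) (f : V → ℝ) :
    wInner w S (f + killedOp w c S f) (f + killedOp w c S f) -
        wInner w S (killedOp w c S (f + killedOp w c S f)) (f + killedOp w c S f) ≤
      2 * (wInner w S f f - wInner w S (killedOp w c S f) (killedOp w c S f)) := by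
  have h := (abs_le.1 (abs_wInner_killedOp_le S H (f - killedOp w c S f))).1
  simp only [map_add, map_sub, wInner_add_left, wInner_add_right, wInner_sub_left,
    wInner_sub_right] at h ⊢
  have e1 := wInner_killedOp_symm S H f (killedOp w c S f)
  have e2 := wInner_killedOp_symm S H (killedOp w c S f) f
  have e3 := wInner_comm (w := w) S f (killedOp w c S f)
  linarith

theorem wInner_killedOp_self_le (H : IsNetwork w c) (f : V → ℝ) :
    wInner w S (killedOp w c S f) (killedOp w c S f) ≤ wInner w S f f := by
  have h := dirichlet_add_le S H f
  have h' := (abs_le.1 (abs_wInner_killedOp_le S H (f + killedOp w c S f))).2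
  linarith

open Polynomial in
theorem chebyshev_pell (n : ℕ) :
    Chebyshev.T ℝ (n + 1) ^ 2 + (1 - X ^ 2) * Chebyshev.U ℝ n ^ 2 = 1 := by
  induction n with
  | zero => simp
  | succ n ih =>
    have h1 := Chebyshev.T_eq_X_mul_T_sub_pol_U ℝ n
    have h2 := Chebyshev.U_eq_X_mul_U_add_T ℝ n
    push_cast
    rw [show (n : ℤ) + 1 + 1 = n + 2 by ring, h1, h2]
    linear_combination ih

open Polynomial in
theorem wInner_aeval_symm (H : IsNetwork w c) (P : ℝ[X]) (f g : V → ℝ) :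
    wInner w S (aeval (killedOp w c S) P f) g = wInner w S f (aeval (killedOp w c S) P g) := by
  induction P using Polynomial.induction_on' with
  | add p q hp hq =>
    simp only [map_add, LinearMap.add_apply, wInner_add_left, wInner_add_right, hp, hq]
  | monomial n a =>
    have h0 : ∀ n : ℕ, ∀ f g : V → ℝ, wInner w S ((killedOp w c S ^ n) f) g =
        wInner w S f ((killedOp w c S ^ n) g) := by
      intro n
      induction n with
      | zero => intro f g; simp
      | succ n ih =>
        intro f g
        rw [pow_succ, Module.End.mul_apply, ih, wInner_killedOp_symm S H, ← Module.End.mul_apply,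
          ← pow_succ', pow_succ]
    have h1 : ∀ u v : V → ℝ, wInner w S (a • u) v = wInner w S u (a • v) := by
      intro u v
      refine Finset.sum_congr rfl fun x _ => ?_
      simp only [Pi.smul_apply, smul_eq_mul]
      ring
    simp only [aeval_monomial, Module.algebraMap_end_eq_smul_id, smul_mul_assoc]
    simp only [LinearMap.smul_apply, Module.End.mul_apply, LinearMap.id_apply]
    rw [h1, h0]
    congr 1
    simp

open Polynomial in
theorem wInner_chebyshev_le (H : IsNetwork w c) (k : ℤ) (f : V → ℝ) :
    wInner w S (aeval (killedOp w c S) (Chebyshev.T ℝ k) f)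
      (aeval (killedOp w c S) (Chebyshev.T ℝ k) f) ≤ wInner w S f f := by
  wlog hk : 0 ≤ k generalizing k
  · have := this (-k) (by omega)
    rwa [Chebyshev.T_neg] at this
  obtain ⟨n, rfl⟩ := Int.eq_ofNat_of_zero_le hk
  cases n with
  | zero => simp
  | succ n =>
    have h := congrArg (fun P => aeval (killedOp w c S) P f) (chebyshev_pell n)
    set U := aeval (killedOp w c S) (Chebyshev.U ℝ n) with hU
    set T := aeval (killedOp w c S) (Chebyshev.T ℝ (n + 1)) with hT
    have h' : wInner w S (T (T f)) f + wInner w S (U (U f)) f -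
        wInner w S (killedOp w c S (killedOp w c S (U (U f)))) f = wInner w S f f := by
      rw [← wInner_add_left, ← wInner_sub_left]
      congr 1
      have e : T (T f) + U (U f) - killedOp w c S (killedOp w c S (U (U f))) = f := by
        have h2 := h
        simp only [map_add, map_mul, map_sub, map_one, aeval_X, ← hU, ← hT, pow_two,
          sub_mul, one_mul, LinearMap.add_apply, LinearMap.sub_apply, Module.End.mul_apply,
          Module.End.one_apply] at h2
        rw [← add_sub_assoc] at h2
        exact h2
      exact e
    have hcomm : killedOp w c S (killedOp w c S (U (U f))) =
        U (killedOp w c S (killedOp w c S (U f))) := by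
      have : killedOp w c S * killedOp w c S * U = U * (killedOp w c S * killedOp w c S) := by
        rw [hU]
        have := congrArg (aeval (killedOp w c S))
          (mul_comm (X * X : ℝ[X]) (Chebyshev.U ℝ n))
        simpa only [map_mul, aeval_X] using this
      exact congrArg (fun L : Module.End ℝ (V → ℝ) => L (U f)) this
    have sT : ∀ u v, wInner w S (T u) v = wInner w S u (T v) := wInner_aeval_symm S H _
    have sU : ∀ u v, wInner w S (U u) v = wInner w S u (U v) := wInner_aeval_symm S H _
    rw [hcomm, sT, sU (U f), sU _ f, wInner_killedOp_symm S H] at h'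
    have := wInner_killedOp_self_le S H (U f)
    push_cast
    rw [← hT]
    rw [wInner_comm S f, wInner_killedOp_symm S H, ← wInner_killedOp_symm S H] at h'
    linarith

end Killed

/-! ### Integrated Varadhan–Carne bound for exit probabilities -/

open Polynomial in
theorem two_pow_mul_X_pow_eq_sum_chebyshev (m : ℕ) :
    (2 : ℝ[X]) ^ m * X ^ m =
      ∑ ij ∈ Finset.HasAntidiagonal.antidiagonal m,
        (m.choose ij.1 : ℝ[X]) * Chebyshev.T ℝ ((ij.1 : ℤ) - ij.2) := by
  induction m with
  | zero => simp
  | succ m ih =>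
    rw [Finset.sum_antidiagonal_choose_succ_mul
      (fun i j => Chebyshev.T ℝ ((i : ℤ) - j)), ← Finset.sum_add_distrib,
      show (2 : ℝ[X]) ^ (m + 1) * X ^ (m + 1) = 2 * X * (2 ^ m * X ^ m) by ring, ih,
      Finset.mul_sum]
    refine Finset.sum_congr rfl fun ij hij => ?_
    have hc : m.choose ij.2 = m.choose ij.1 :=
      (Nat.choose_symm_of_eq_add (Finset.HasAntidiagonal.mem_antidiagonal.1 hij).symm).symm
    have h := Chebyshev.T_add_one ℝ ((ij.1 : ℤ) - ij.2)
    push_cast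
    rw [hc, show (ij.1 : ℤ) - (ij.2 + 1) = ij.1 - ij.2 - 1 by ring,
      show (ij.1 : ℤ) + 1 - ij.2 = ij.1 - ij.2 + 1 by ring, h]
    ring

theorem sum_choose_mul_exp_le (m : ℕ) (s : ℝ) :
    ∑ ij ∈ Finset.HasAntidiagonal.antidiagonal m, (m.choose ij.1 : ℝ) * Real.exp (s * ((ij.1 : ℝ) - ij.2)) ≤
      2 ^ m * Real.exp (m * s ^ 2 / 2) := by
  have h : ∑ ij ∈ Finset.HasAntidiagonal.antidiagonal m, (m.choose ij.1 : ℝ) *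
      Real.exp (s * ((ij.1 : ℝ) - ij.2)) = (2 * Real.cosh s) ^ m := by
    rw [Real.cosh_eq, mul_div_cancel₀ _ (two_ne_zero), (Commute.all _ _).add_pow']
    refine Finset.sum_congr rfl fun ij _ => ?_
    rw [nsmul_eq_mul, ← Real.exp_nat_mul, ← Real.exp_nat_mul, ← Real.exp_add]
    congr 2
    ring
  rw [h, mul_pow]
  gcongr
  calc Real.cosh s ^ m ≤ Real.exp (s ^ 2 / 2) ^ m := by
        gcongr
        exact Real.cosh_le_exp_half_sq s
    _ = _ := by
        rw [← Real.exp_nat_mul]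
        congr 1
        ring

open Polynomial in
theorem sum_one_sub_killedOp_pow_le {V : Type*} {w : V → ℝ} {c : V → V → ℝ}
    (H : IsNetwork w c) {A S : Finset V} (hAS : A ⊆ S) {L : ℝ} (hL : 0 < L)
    (hloc : ∀ j : ℕ, (j : ℝ) ≤ L → ∀ x ∈ A,
      aeval (killedOp w c S) (Chebyshev.T ℝ j) (fun _ => 1) x = 1)
    {m : ℕ} (hm : 1 ≤ m) (B : ℕ) :
    ∑ x ∈ A, w x * (1 - (killedOp w c S ^ m) (fun _ => 1) x) ≤
      4 * (B.factorial * (2 * m / L ^ 2) ^ B) * ∑ x ∈ S, w x := by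
  set W := ∑ x ∈ S, w x with hW
  set T : ℤ → V → ℝ := fun k => aeval (killedOp w c S) (Chebyshev.T ℝ k) (fun _ => 1) with hT
  have hW0 : 0 ≤ W := Finset.sum_nonneg fun x _ => (H.pos x).le
  set b : ℤ → ℝ := fun k => ∑ x ∈ A, w x * (1 - T k x) with hb
  have hb0 : ∀ k : ℤ, |(k : ℝ)| ≤ L → b k = 0 := by
    intro k hk
    refine Finset.sum_eq_zero fun x hx => ?_
    have h1 : T k = T (k.natAbs : ℤ) := by
      rcases Int.natAbs_eq k with h | h
      · rw [← h]
      · conv_lhs => rw [h]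
        simp only [hT, Chebyshev.T_neg]
    have h2 := hloc k.natAbs (by rwa [Nat.cast_natAbs, Int.cast_abs]) x hx
    rw [h1]
    simp only [hT] at h2 ⊢
    rw [h2]
    ring
  have hb1 : ∀ k : ℤ, b k ≤ 2 * W := by
    intro k
    have h1 := wInner_chebyshev_le S H k (fun _ => 1)
    have h2 : b k ≤ ∑ x ∈ A, (3 / 2 * w x + 1 / 2 * (w x * T k x * T k x)) := by
      refine Finset.sum_le_sum fun x _ => ?_
      have := mul_nonneg (H.pos x).le (sq_nonneg (1 + T k x))
      linarith
    have h3 : ∑ x ∈ A, (3 / 2 * w x + 1 / 2 * (w x * T k x * T k x)) ≤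
        ∑ x ∈ S, (3 / 2 * w x + 1 / 2 * (w x * T k x * T k x)) := by
      refine Finset.sum_le_sum_of_subset_of_nonneg hAS fun x _ _ => ?_
      have := mul_nonneg (H.pos x).le (sq_nonneg (T k x))
      nlinarith [H.pos x]
    have h4 : wInner w S (fun _ => 1) (fun _ => 1) = W := by simp [wInner, hW]
    simp only [Finset.sum_add_distrib, ← Finset.mul_sum] at h2 h3
    change wInner w S (T k) (T k) ≤ _ at h1
    rw [h4] at h1
    simp only [wInner] at h1
    linarith
  set s : ℝ := L / m with hs
  have hm0 : (0 : ℝ) < m := by exact_mod_cast hm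
  have hs0 : 0 ≤ s := by positivity
  have hb2 : ∀ k : ℤ, b k ≤ 2 * W * Real.exp (-(s * L)) *
      (Real.exp (s * k) + Real.exp (-s * k)) := by
    intro k
    by_cases hk : |(k : ℝ)| ≤ L
    · rw [hb0 k hk]
      positivity
    · refine (hb1 k).trans ?_
      rw [mul_assoc]
      refine le_mul_of_one_le_right (by positivity) ?_
      rw [mul_add, ← Real.exp_add, ← Real.exp_add]
      push Not at hk
      rcases le_total 0 (k : ℝ) with h0 | h0
      · rw [abs_of_nonneg h0] at hk
        have : 1 ≤ Real.exp (-(s * L) + s * k) := Real.one_le_exp (by nlinarith)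
        linarith [Real.exp_pos (-(s * L) + -s * k)]
      · rw [abs_of_nonpos h0] at hk
        have : 1 ≤ Real.exp (-(s * L) + -s * k) := Real.one_le_exp (by nlinarith)
        linarith [Real.exp_pos (-(s * L) + s * k)]
  have hsum : (2 : ℝ) ^ m * ∑ x ∈ A, w x * (1 - (killedOp w c S ^ m) (fun _ => 1) x) =
      ∑ ij ∈ Finset.HasAntidiagonal.antidiagonal m, (m.choose ij.1 : ℝ) * b ((ij.1 : ℤ) - ij.2) := by
    have h1 : ∀ x, (2 : ℝ) ^ m * (killedOp w c S ^ m) (fun _ => 1) x =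
        ∑ ij ∈ Finset.HasAntidiagonal.antidiagonal m, (m.choose ij.1 : ℝ) * T ((ij.1 : ℤ) - ij.2) x := by
      intro x
      have h := congrArg (fun P => aeval (killedOp w c S) P (fun _ => 1) x)
        (two_pow_mul_X_pow_eq_sum_chebyshev m)
      have hc : ∀ a : ℝ, ∀ M : Module.End ℝ (V → ℝ),
          (aeval (killedOp w c S) (C a) * M) (fun _ => 1) x = a * M (fun _ => 1) x := by
        intro a M
        rw [aeval_C, Module.algebraMap_end_eq_smul_id]
        rfl
      have e2 : (2 : ℝ[X]) ^ m = C ((2 : ℝ) ^ m) := by rw [map_pow, map_ofNat C 2]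
      have e3 : ∀ i : ℕ, (i : ℝ[X]) = C (i : ℝ) := by simp
      simp only [map_mul, map_sum, e2, e3, LinearMap.sum_apply, Finset.sum_apply, hc, map_pow,
        aeval_X] at h
      simp only [← map_pow, hc] at h
      exact h
    have h2 : ∑ ij ∈ Finset.HasAntidiagonal.antidiagonal m, (m.choose ij.1 : ℝ) = 2 ^ m := by
      rw [Finset.Nat.sum_antidiagonal_eq_sum_range_succ (fun i _ => (m.choose i : ℝ))]
      exact_mod_cast Nat.sum_range_choose m
    simp only [hb, Finset.mul_sum]
    rw [Finset.sum_comm]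
    refine Finset.sum_congr rfl fun x _ => ?_
    rw [show (2 : ℝ) ^ m * (w x * (1 - (killedOp w c S ^ m) (fun _ => 1) x)) =
      w x * ((2 : ℝ) ^ m - 2 ^ m * (killedOp w c S ^ m) (fun _ => 1) x) by ring, h1, ← h2,
      ← Finset.sum_sub_distrib, Finset.mul_sum]
    exact Finset.sum_congr rfl fun ij _ => by ring
  have hexp : ∑ ij ∈ Finset.HasAntidiagonal.antidiagonal m, (m.choose ij.1 : ℝ) * b ((ij.1 : ℤ) - ij.2) ≤
      2 ^ m * (4 * Real.exp (-(L ^ 2 / (2 * m))) * W) := by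
    have e0 : -(s * L) + m * s ^ 2 / 2 = -(L ^ 2 / (2 * m)) := by
      rw [hs]
      field_simp
      ring
    have h1 := sum_choose_mul_exp_le m s
    have h2 := sum_choose_mul_exp_le m (-s)
    rw [neg_sq] at h2
    calc _ ≤ ∑ ij ∈ Finset.HasAntidiagonal.antidiagonal m, 2 * W * Real.exp (-(s * L)) *
          ((m.choose ij.1 : ℝ) * Real.exp (s * ((ij.1 : ℝ) - ij.2)) +
            (m.choose ij.1 : ℝ) * Real.exp (-s * ((ij.1 : ℝ) - ij.2))) := by
          refine Finset.sum_le_sum fun ij _ => ?_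
          have := mul_le_mul_of_nonneg_left (hb2 ((ij.1 : ℤ) - ij.2))
            (Nat.cast_nonneg (α := ℝ) (m.choose ij.1))
          push_cast at this
          linarith
      _ ≤ 2 * W * Real.exp (-(s * L)) * (2 ^ m * Real.exp (m * s ^ 2 / 2) +
            2 ^ m * Real.exp (m * s ^ 2 / 2)) := by
          rw [← Finset.mul_sum, Finset.sum_add_distrib]
          gcongr
      _ = _ := by
          rw [← e0, Real.exp_add]
          ring
  have hpoly : Real.exp (-(L ^ 2 / (2 * m))) ≤ B.factorial * (2 * m / L ^ 2) ^ B := by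
    have h := Real.pow_div_factorial_le_exp (x := L ^ 2 / (2 * m)) (by positivity) B
    rw [Real.exp_neg, inv_le_comm₀ (Real.exp_pos _) (by positivity)]
    refine le_trans (le_of_eq ?_) h
    rw [mul_inv, ← inv_pow, inv_div]
    ring
  have hfin : ∑ x ∈ A, w x * (1 - (killedOp w c S ^ m) (fun _ => 1) x) ≤
      4 * Real.exp (-(L ^ 2 / (2 * m))) * W := by
    rw [← hsum] at hexp
    exact le_of_mul_le_mul_left hexp (by positivity)
  refine hfin.trans ?_
  gcongr

/-! ### Cubes of `ℤ^d` and the random conductance network -/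

/-- The lattice cube with centre `a` and (real) radius `r`. -/
def cube (d : ℕ) (a : Vert d) (r : ℝ) : Finset (Vert d) :=
  Fintype.piFinset fun i => Finset.Icc ⌈(a i : ℝ) - r⌉ ⌊(a i : ℝ) + r⌋

theorem mem_cube {d : ℕ} {a x : Vert d} {r : ℝ} :
    x ∈ cube d a r ↔ ∀ i, |(x i : ℝ) - a i| ≤ r := by
  simp only [cube, Fintype.mem_piFinset, Finset.mem_Icc, Int.ceil_le, Int.le_floor, abs_le]
  refine forall_congr' fun i => ?_
  constructor <;> rintro ⟨h1, h2⟩ <;> constructor <;> linarith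

theorem mem_box {d : ℕ} {x : Vert d} {r : ℝ} : x ∈ box d r ↔ ∀ i, |(x i : ℝ)| ≤ r := by
  simp only [box, Fintype.mem_piFinset, Finset.mem_Icc, Int.ceil_le, Int.le_floor, abs_le]

theorem cube_zero (d : ℕ) (r : ℝ) : cube d 0 r = box d r := by
  ext x
  simp [mem_cube, mem_box]

theorem cube_subset_cube {d : ℕ} {a b : Vert d} {r s t : ℝ}
    (hab : ∀ i, |(a i : ℝ) - b i| ≤ t) (h : r + t ≤ s) : cube d a r ⊆ cube d b s := by
  intro x hx
  rw [mem_cube] at hx ⊢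
  intro i
  have h1 := abs_le.1 (hx i)
  have h2 := abs_le.1 (hab i)
  rw [abs_le]
  constructor <;> linarith

theorem cube_mono {d : ℕ} {a : Vert d} {r s : ℝ} (h : r ≤ s) : cube d a r ⊆ cube d a s :=
  cube_subset_cube (t := 0) (by simp) (by simpa using h)

section Network

variable {d : ℕ} (ω : EnvSp d)

theorem abs_unitv_le (i j : Fin d) : |((unitv d i j : ℤ) : ℝ)| ≤ 1 := by
  unfold unitv
  split_ifs <;> simp

theorem piOf_pos (hd : 0 < d) (x : Vert d) : 0 < piOf d ω x := by
  have : Nonempty (Fin d) := ⟨⟨0, hd⟩⟩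
  exact Finset.sum_pos (fun i _ => add_pos (ω.2 _) (ω.2 _)) Finset.univ_nonempty

theorem cnd_nonneg (x y : Vert d) : 0 ≤ cnd d ω x y :=
  Finset.sum_nonneg fun i _ => add_nonneg (by split_ifs <;> simp [(ω.2 _).le])
    (by split_ifs <;> simp [(ω.2 _).le])

theorem cnd_comm (x y : Vert d) : cnd d ω x y = cnd d ω y x :=
  Finset.sum_congr rfl fun _ _ => add_comm _ _

theorem sum_cnd_mul (S : Finset (Vert d)) (x : Vert d) (f : Vert d → ℝ) :
    ∑ y ∈ S, cnd d ω x y * f y =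
      ∑ i, ((if x + unitv d i ∈ S then ω.1 (x, i) * f (x + unitv d i) else 0) +
        (if x - unitv d i ∈ S then ω.1 (x - unitv d i, i) * f (x - unitv d i) else 0)) := by
  simp only [cnd, Finset.sum_mul, add_mul, ite_mul, zero_mul]
  rw [Finset.sum_comm]
  refine Finset.sum_congr rfl fun i _ => ?_
  rw [Finset.sum_add_distrib, Finset.sum_ite_eq']
  simp only [← sub_eq_iff_eq_add (b := unitv d i)]
  rw [Finset.sum_ite_eq]

theorem sum_cnd_le (S : Finset (Vert d)) (x : Vert d) : ∑ y ∈ S, cnd d ω x y ≤ piOf d ω x := by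
  have h := sum_cnd_mul ω S x (fun _ => 1)
  simp only [mul_one] at h
  rw [h]
  refine Finset.sum_le_sum fun i _ => add_le_add ?_ ?_ <;> split_ifs <;> simp [(ω.2 _).le]

theorem sum_cnd_eq {S : Finset (Vert d)} {x : Vert d}
    (h : ∀ i, x + unitv d i ∈ S ∧ x - unitv d i ∈ S) : ∑ y ∈ S, cnd d ω x y = piOf d ω x := by
  have h' := sum_cnd_mul ω S x (fun _ => 1)
  simp only [mul_one, h, if_true] at h'
  exact h'

theorem isNetwork_cnd (hd : 0 < d) : IsNetwork (piOf d ω) (cnd d ω) where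
  pos := piOf_pos ω hd
  nonneg := cnd_nonneg ω
  symm := cnd_comm ω
  sum_le S x := sum_cnd_le ω S x

theorem abs_sub_le_one_of_cnd_ne_zero {x y : Vert d} (h : cnd d ω x y ≠ 0) (i : Fin d) :
    |(y i : ℝ) - x i| ≤ 1 := by
  obtain ⟨j, -, hj⟩ := Finset.exists_ne_zero_of_sum_ne_zero h
  have hj' : y = x + unitv d j ∨ x = y + unitv d j := by
    by_contra hcon
    push Not at hcon
    simp [hcon.1, hcon.2] at hj
  have := abs_unitv_le j i
  rcases hj' with rfl | rfl
  · simpa using this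
  · simpa using this

theorem killedOp_apply_eq_one (hd : 0 < d) {S : Finset (Vert d)} {x : Vert d} {g : Vert d → ℝ}
    (hx : cube d x 1 ⊆ S) (hg : ∀ y, cnd d ω x y ≠ 0 → g y = 1) :
    killedOp (piOf d ω) (cnd d ω) S g x = 1 := by
  have hn : ∀ i, x + unitv d i ∈ S ∧ x - unitv d i ∈ S := fun i =>
    ⟨hx (mem_cube.2 fun k => by simpa using abs_unitv_le i k),
      hx (mem_cube.2 fun k => by simpa using abs_unitv_le i k)⟩
  rw [killedOp_apply]
  calc _ = ∑ y ∈ S, cnd d ω x y / piOf d ω x := by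
        refine Finset.sum_congr rfl fun y _ => ?_
        by_cases h : cnd d ω x y = 0
        · simp [h]
        · rw [hg y h, mul_one]
    _ = 1 := by
        rw [← Finset.sum_div, sum_cnd_eq ω hn, div_self (piOf_pos ω hd x).ne']

/-- The walk cannot leave a cube of radius `m` in `m` steps. -/
theorem killedOp_pow_one_apply (hd : 0 < d) {S : Finset (Vert d)} (m : ℕ) :
    ∀ x, cube d x m ⊆ S → (killedOp (piOf d ω) (cnd d ω) S ^ m) (fun _ => 1) x = 1 := by
  induction m with
  | zero => intro x _; rfl
  | succ m ih =>
    intro x hx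
    rw [pow_succ']
    exact killedOp_apply_eq_one ω hd
      ((cube_mono (by push_cast; linarith [(Nat.cast_nonneg m : (0 : ℝ) ≤ m)])).trans hx)
      fun y hy => ih y ((cube_subset_cube (t := 1) (abs_sub_le_one_of_cnd_ne_zero ω hy)
        (by push_cast; linarith)).trans hx)

open Polynomial in
/-- Chebyshev polynomials of the killed transition operator fix the constant function
at points that are far from the complement of `S`. -/
theorem aeval_chebyshev_one_apply (hd : 0 < d) {S : Finset (Vert d)} (j : ℕ) :
    ∀ x, cube d x j ⊆ S →
      aeval (killedOp (piOf d ω) (cnd d ω) S) (Chebyshev.T ℝ j) (fun _ => 1) x = 1 := by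
  induction j using Nat.twoStepInduction with
  | zero => intro x _; simp
  | one =>
    intro x hx
    simp only [Nat.cast_one, Chebyshev.T_one, aeval_X]
    exact killedOp_apply_eq_one ω hd (by simpa using hx) fun _ _ => rfl
  | more j ih0 ih1 =>
    intro x hx
    have e : Chebyshev.T ℝ ((j + 2 : ℕ) : ℤ) =
        2 * (X * Chebyshev.T ℝ ((j + 1 : ℕ) : ℤ)) - Chebyshev.T ℝ (j : ℤ) := by
      have := Chebyshev.T_add_two ℝ (j : ℤ)
      push_cast
      rw [this]
      ring
    have e2 : (2 : ℝ[X]) = C 2 := rfl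
    rw [e, map_sub, map_mul, map_mul, aeval_X, e2, aeval_C, Module.algebraMap_end_eq_smul_id]
    have h0 := ih0 x ((cube_mono (by push_cast; linarith)).trans hx)
    have h1 := killedOp_apply_eq_one ω hd (x := x) (g := aeval (killedOp (piOf d ω) (cnd d ω) S)
      (Chebyshev.T ℝ ((j + 1 : ℕ) : ℤ)) (fun _ => 1))
      ((cube_mono (by push_cast; linarith [(Nat.cast_nonneg j : (0 : ℝ) ≤ j)])).trans hx)
      (fun y hy => ih1 y ((cube_subset_cube (t := 1) (abs_sub_le_one_of_cnd_ne_zero ω hy)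
        (by push_cast; linarith)).trans hx))
    rw [LinearMap.sub_apply, Pi.sub_apply, h0]
    change (2 : ℝ) • (killedOp (piOf d ω) (cnd d ω) S
      (aeval (killedOp (piOf d ω) (cnd d ω) S)
        (Chebyshev.T ℝ ((j + 1 : ℕ) : ℤ)) (fun _ => 1)) x) - 1 = 1
    rw [h1]
    norm_num

/-- Carne–Varopoulos type bound for the probability of leaving `S` from `A`,
when every point of `A` has distance at least `L` from the complement of `S`. -/
theorem sum_exit_le (hd : 0 < d) {A S : Finset (Vert d)} {L : ℝ} (hL : 0 < L)
    (hAS : ∀ x ∈ A, cube d x L ⊆ S) {m : ℕ} (hm : 1 ≤ m) (B : ℕ) :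
    ∑ x ∈ A, piOf d ω x *
        (1 - (killedOp (piOf d ω) (cnd d ω) S ^ m) (fun _ => 1) x) ≤
      4 * (B.factorial * (2 * m / L ^ 2) ^ B) * ∑ x ∈ S, piOf d ω x :=
  sum_one_sub_killedOp_pow_le (isNetwork_cnd ω hd)
    (fun x hx => hAS x hx (mem_cube.2 fun i => by simpa using hL.le)) hL
    (fun j hj x hx => aeval_chebyshev_one_apply ω hd j x ((cube_mono hj).trans (hAS x hx))) hm B

end Network

/-! ### Sobolev inequality on `ℤ^d` -/

theorem pi_count_eq_count (d : ℕ) :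
    Measure.pi (fun _ : Fin d => (Measure.count : Measure ℤ)) = Measure.count := by
  refine Measure.ext_of_singleton fun a => ?_
  rw [Measure.count_singleton, ← Set.univ_pi_singleton, Measure.pi_pi]
  simp

theorem ofReal_abs_le_tsum {g : ℤ → ℝ} {t : ℤ} (n : ℕ) (hn : g (t + n) = 0) :
    ENNReal.ofReal |g t| ≤ ∑' s, ENNReal.ofReal |g (s + 1) - g s| := by
  have h1 : |g t| ≤ ∑ k ∈ Finset.range n, |g (t + k + 1) - g (t + k)| := by
    have h := Finset.sum_range_sub (fun k : ℕ => g (t + k)) n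
    rw [hn] at h
    calc |g t| = |∑ k ∈ Finset.range n, (g (t + (k + 1 : ℕ)) - g (t + k))| := by
          rw [h]; simp
      _ ≤ _ := by
          refine (Finset.abs_sum_le_sum_abs _ _).trans_eq (Finset.sum_congr rfl fun k _ => ?_)
          push_cast
          rw [add_assoc]
  calc ENNReal.ofReal |g t|
      ≤ ENNReal.ofReal (∑ k ∈ Finset.range n, |g (t + k + 1) - g (t + k)|) :=
        ENNReal.ofReal_le_ofReal h1
    _ = ∑ k ∈ Finset.range n, ENNReal.ofReal |g (t + k + 1) - g (t + k)| :=
        ENNReal.ofReal_sum_of_nonneg fun _ _ => abs_nonneg _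
    _ ≤ ∑' k : ℕ, ENNReal.ofReal |g (t + k + 1) - g (t + k)| := ENNReal.sum_le_tsum _
    _ ≤ _ := ENNReal.tsum_comp_le_tsum_of_injective (f := fun k : ℕ => t + k)
        (fun a b h => by simpa using h) (fun s => ENNReal.ofReal |g (s + 1) - g s|)

theorem tsum_rpow_le {d : ℕ} (hd : 2 ≤ d) {S : Finset (Vert d)} {F : Vert d → ℝ}
    (hF : ∀ x ∉ S, F x = 0) :
    ∑' x, ENNReal.ofReal |F x| ^ ((d : ℝ) / (d - 1)) ≤
      (∑' x, ∑ i, ENNReal.ofReal |F (x + unitv d i) - F x|) ^ ((d : ℝ) / (d - 1)) := by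
  have hd1 : (1 : ℝ) < d := by exact_mod_cast hd
  have hd0 : (0 : ℝ) < d - 1 := by linarith
  set G : Vert d → ℝ≥0∞ := fun x => ∑ i, ENNReal.ofReal |F (x + unitv d i) - F x| with hG
  have hconj : Real.HolderConjugate (Fintype.card (Fin d)) ((d : ℝ) / (d - 1)) := by
    rw [Fintype.card_fin]
    exact (Real.holderConjugate_iff_eq_conjExponent hd1).2 rfl
  have hGm : Measurable G := measurable_of_countable _
  have h := lintegral_prod_lintegral_pow_le (fun _ : Fin d => (Measure.count : Measure ℤ))
    hconj hGm
  rw [pi_count_eq_count, lintegral_count, lintegral_count] at h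
  refine le_trans (ENNReal.tsum_le_tsum fun x => ?_) h
  have hx : ∀ i, ENNReal.ofReal |F x| ≤
      ∫⁻ s, G (Function.update x i s) ∂(Measure.count : Measure ℤ) := by
    intro i
    rw [lintegral_count]
    have hinj : Function.Injective fun n : ℕ => Function.update x i (x i + n) := fun a b hab => by
      simpa using congrFun hab i
    obtain ⟨n, hn⟩ := Infinite.exists_notMem_finset (S.preimage _ hinj.injOn)
    rw [Finset.mem_preimage] at hn
    have h1 := ofReal_abs_le_tsum (g := fun s => F (Function.update x i s)) (t := x i) n
      (hF _ hn)
    simp only [Function.update_eq_self] at h1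
    refine h1.trans (ENNReal.tsum_le_tsum fun s => ?_)
    have e : Function.update x i (s + 1) = Function.update x i s + unitv d i := by
      funext j
      by_cases hj : j = i
      · subst hj; simp [unitv]
      · simp [unitv, hj]
    rw [e]
    exact Finset.single_le_sum
      (f := fun i => ENNReal.ofReal
        |F (Function.update x _ s + unitv d i) - F (Function.update x _ s)|)
      (fun _ _ => zero_le) (Finset.mem_univ i)
  calc ENNReal.ofReal |F x| ^ ((d : ℝ) / (d - 1))
      = ∏ _i : Fin d, ENNReal.ofReal |F x| ^ ((1 : ℝ) / (d - 1)) := by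
        rw [Finset.prod_const, Finset.card_univ, Fintype.card_fin, ← ENNReal.rpow_natCast,
          ← ENNReal.rpow_mul]
        congr 1
        field_simp
    _ ≤ _ := by
        rw [Fintype.card_fin]
        exact Finset.prod_le_prod' fun i _ => ENNReal.rpow_le_rpow (hx i) (by positivity)

theorem mem_edgesIn {d : ℕ} {S : Finset (Vert d)} {e : EdgeIx d} :
    e ∈ edgesIn d S ↔ e.1 ∈ S ∨ e.1 + unitv d e.2 ∈ S := by
  obtain ⟨x, i⟩ := e
  simp only [edgesIn, Finset.mem_biUnion, Finset.mem_union, Finset.mem_image, Finset.mem_univ,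
    true_and, Prod.mk.injEq]
  constructor
  · rintro ⟨y, hy, ⟨j, rfl, rfl⟩ | ⟨j, rfl, rfl⟩⟩
    · exact Or.inl hy
    · right; simpa using hy
  · rintro (h | h)
    · exact ⟨x, h, Or.inl ⟨i, rfl, rfl⟩⟩
    · exact ⟨_, h, Or.inr ⟨i, by simp, rfl⟩⟩

/-- The `ℓ¹` Sobolev (isoperimetric) inequality for finitely supported functions on `ℤ^d`. -/
theorem sum_rpow_le_sum_edges {d : ℕ} (hd : 2 ≤ d) {S : Finset (Vert d)} {F : Vert d → ℝ}
    (hF : ∀ x ∉ S, F x = 0) :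
    ∑ x ∈ S, |F x| ^ ((d : ℝ) / (d - 1)) ≤
      (∑ e ∈ edgesIn d S, |F (e.1 + unitv d e.2) - F e.1|) ^ ((d : ℝ) / (d - 1)) := by
  have hd1 : (1 : ℝ) < d := by exact_mod_cast hd
  have hpos : 0 ≤ (d : ℝ) / (d - 1) := div_nonneg (by linarith) (by linarith)
  have h := tsum_rpow_le hd hF
  have e1 : ∑' x, ∑ i, ENNReal.ofReal |F (x + unitv d i) - F x| =
      ENNReal.ofReal (∑ e ∈ edgesIn d S, |F (e.1 + unitv d e.2) - F e.1|) := by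
    rw [ENNReal.ofReal_sum_of_nonneg fun _ _ => abs_nonneg _]
    have : ∑' x, ∑ i, ENNReal.ofReal |F (x + unitv d i) - F x| =
        ∑' e : EdgeIx d, ENNReal.ofReal |F (e.1 + unitv d e.2) - F e.1| := by
      rw [ENNReal.tsum_prod' (f := fun e : EdgeIx d =>
        ENNReal.ofReal |F (e.1 + unitv d e.2) - F e.1|)]
      exact tsum_congr fun x => (tsum_fintype _).symm
    rw [this]
    refine tsum_eq_sum fun e he => ?_
    rw [mem_edgesIn, not_or] at he
    simp [hF _ he.1, hF _ he.2]
  rw [e1, ENNReal.ofReal_rpow_of_nonneg (Finset.sum_nonneg fun _ _ => abs_nonneg _) hpos] at h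
  have h2 := (ENNReal.sum_le_tsum S).trans h
  simp only [ENNReal.ofReal_rpow_of_nonneg (abs_nonneg _) hpos] at h2
  rw [← ENNReal.ofReal_sum_of_nonneg fun _ _ => by positivity] at h2
  exact (ENNReal.ofReal_le_ofReal_iff (by positivity)).1 h2

theorem abs_rpow_sub_rpow_le {a b γ : ℝ} (ha : 0 ≤ a) (hb : 0 ≤ b) (hγ : 1 ≤ γ) :
    |a ^ γ - b ^ γ| ≤ γ * ((a ^ (γ - 1) + b ^ (γ - 1)) * |a - b|) := by
  have key : ∀ a b : ℝ, 0 ≤ a → a ≤ b → b ^ γ - a ^ γ ≤ γ * (b ^ (γ - 1) * (b - a)) := by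
    intro a b ha hab
    rcases (ha.trans hab).eq_or_lt with hb | hb
    · have : a = 0 := by linarith
      simp [this, ← hb]
    · have h := one_add_mul_self_le_rpow_one_add (s := a / b - 1)
        (by have := div_nonneg ha hb.le; linarith) hγ
      rw [add_sub_cancel, Real.div_rpow ha hb.le, le_div_iff₀ (by positivity)] at h
      have e : b ^ γ = b ^ (γ - 1) * b := by
        rw [← Real.rpow_add_one hb.ne', sub_add_cancel]
      calc b ^ γ - a ^ γ ≤ b ^ γ - (1 + γ * (a / b - 1)) * b ^ γ := by linarith
        _ = _ := by
          rw [e]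
          field_simp
          ring
  have h1 : (0 : ℝ) ≤ a ^ (γ - 1) := by positivity
  have h2 : (0 : ℝ) ≤ b ^ (γ - 1) := by positivity
  rcases le_total a b with h | h
  · have hk := key a b ha h
    have hm := Real.rpow_le_rpow ha h (by linarith : 0 ≤ γ)
    rw [abs_of_nonpos (by linarith), abs_of_nonpos (by linarith)]
    have : 0 ≤ γ * (a ^ (γ - 1) * (b - a)) := by
      have : 0 ≤ b - a := by linarith
      positivity
    nlinarith
  · have hk := key b a hb h
    have hm := Real.rpow_le_rpow hb h (by linarith : 0 ≤ γ)
    rw [abs_of_nonneg (by linarith), abs_of_nonneg (by linarith)]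
    have : 0 ≤ γ * (b ^ (γ - 1) * (a - b)) := by
      have : 0 ≤ a - b := by linarith
      positivity
    nlinarith

theorem sum_fst_le {d : ℕ} {S : Finset (Vert d)} {φ : Vert d → ℝ} (hφ : ∀ x, 0 ≤ φ x)
    (hS : ∀ x ∉ S, φ x = 0) (E : Finset (EdgeIx d)) :
    ∑ e ∈ E, φ e.1 ≤ d * ∑ x ∈ S, φ x := by
  calc ∑ e ∈ E, φ e.1 = ∑ e ∈ E with e.1 ∈ S, φ e.1 := by
        refine (Finset.sum_filter_of_ne fun e _ h => ?_).symm
        by_contra hcon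
        exact h (hS _ hcon)
    _ ≤ ∑ e ∈ S ×ˢ (Finset.univ : Finset (Fin d)), φ e.1 :=
        Finset.sum_le_sum_of_subset_of_nonneg
          (fun e he => by simpa using (Finset.mem_filter.1 he).2) fun _ _ _ => hφ _
    _ = d * ∑ x ∈ S, φ x := by
        rw [Finset.sum_product]
        simp [Finset.mul_sum]

theorem sum_snd_le {d : ℕ} {S : Finset (Vert d)} {φ : Vert d → ℝ} (hφ : ∀ x, 0 ≤ φ x)
    (hS : ∀ x ∉ S, φ x = 0) (E : Finset (EdgeIx d)) :
    ∑ e ∈ E, φ (e.1 + unitv d e.2) ≤ d * ∑ x ∈ S, φ x := by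
  have hinj : Function.Injective fun e : EdgeIx d => ((e.1 + unitv d e.2, e.2) : EdgeIx d) := by
    rintro ⟨x, i⟩ ⟨y, j⟩ h
    simp only [Prod.mk.injEq] at h
    obtain ⟨h1, rfl⟩ := h
    simpa using h1
  have h := sum_fst_le hφ hS (E.image fun e : EdgeIx d => ((e.1 + unitv d e.2, e.2) : EdgeIx d))
  rwa [Finset.sum_image hinj.injOn] at h

/-- Weighted Sobolev inequality for the Dirichlet form with conductances `ω`. -/
theorem exists_weighted_sobolev {d : ℕ} (hd : 2 ≤ d) {q ρ : ℝ} (hq : 1 < q) (hρ : 2 ≤ ρ)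
    (hρq : 2 / ρ = 1 - 2 / d + 1 / q) :
    ∃ C : ℝ, 0 < C ∧ ∀ (ω : EnvSp d) (S : Finset (Vert d)) (h : Vert d → ℝ),
      (∀ x ∉ S, h x = 0) →
      (∑ x ∈ S, |h x| ^ ρ) ^ (2 / ρ) ≤ C * (∑ e ∈ edgesIn d S, ω.1 e ^ (-q)) ^ (1 / q) *
        ∑ e ∈ edgesIn d S, ω.1 e * (h (e.1 + unitv d e.2) - h e.1) ^ 2 := by
  have hd2 : (2 : ℝ) ≤ d := by exact_mod_cast hd
  have hd1 : (0 : ℝ) < d - 1 := by linarith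
  have hq0 : 0 < q := by linarith
  have hρ0 : 0 < ρ := by linarith
  set γ : ℝ := ρ * (d - 1) / d with hγd
  set q' : ℝ := q.conjExponent with hq'
  have hconj : q.HolderConjugate q' := (Real.holderConjugate_iff_eq_conjExponent hq).2 rfl
  have hq'0 : 0 < q' := hconj.symm.pos
  have hinv : 1 / q' = 1 - 1 / q := by
    have := hconj.inv_add_inv_eq_one
    rw [one_div, one_div]; linarith
  have hγ1 : 1 ≤ γ := by
    rw [hγd, le_div_iff₀ (by linarith)]
    nlinarith
  have hexp : 2 * q' * (γ - 1) = ρ := by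
    have e1 : 2 / ρ = 2 - 2 / d - 1 / q' := by rw [hinv, hρq]; ring
    rw [hγd]
    field_simp at e1 ⊢
    linarith
  refine ⟨γ ^ 2 * (2 ^ (2 * q') * (2 * d)) ^ (1 / q'), by positivity, ?_⟩
  intro ω S h hS
  set E := edgesIn d S with hE
  set X := ∑ x ∈ S, |h x| ^ ρ with hX
  set W := ∑ e ∈ E, ω.1 e ^ (-q) with hW
  set D := ∑ e ∈ E, ω.1 e * (h (e.1 + unitv d e.2) - h e.1) ^ 2 with hD
  have hX0 : 0 ≤ X := Finset.sum_nonneg fun _ _ => by positivity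
  have hW0 : 0 ≤ W := Finset.sum_nonneg fun e _ => Real.rpow_nonneg (ω.2 e).le _
  have hD0 : 0 ≤ D := Finset.sum_nonneg fun e _ => mul_nonneg (ω.2 e).le (sq_nonneg _)
  rcases hX0.eq_or_lt with hXz | hXp
  · rw [← hXz, Real.zero_rpow (by positivity)]
    positivity
  set k : EdgeIx d → ℝ := fun e => |h (e.1 + unitv d e.2)| ^ (γ - 1) + |h e.1| ^ (γ - 1) with hk
  have hk0 : ∀ e, 0 ≤ k e := fun e => by positivity
  have hsob := sum_rpow_le_sum_edges hd (S := S) (F := fun x => |h x| ^ γ) fun x hx => by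
    simp only [hS x hx, abs_zero]
    exact Real.zero_rpow (by linarith)
  have e1 : ∑ x ∈ S, |(|h x| ^ γ)| ^ ((d : ℝ) / (d - 1)) = X := by
    refine Finset.sum_congr rfl fun x _ => ?_
    rw [abs_of_nonneg (by positivity), ← Real.rpow_mul (abs_nonneg _), hγd]
    congr 1
    field_simp
  rw [e1] at hsob
  set G := ∑ e ∈ E, |(|h (e.1 + unitv d e.2)| ^ γ - |h e.1| ^ γ)| with hG
  have hG0 : 0 ≤ G := Finset.sum_nonneg fun _ _ => abs_nonneg _
  have hG1 : G ≤ γ * ∑ e ∈ E, k e * |h (e.1 + unitv d e.2) - h e.1| := by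
    rw [Finset.mul_sum]
    refine Finset.sum_le_sum fun e _ => (abs_rpow_sub_rpow_le (abs_nonneg _) (abs_nonneg _)
      hγ1).trans ?_
    exact mul_le_mul_of_nonneg_left (mul_le_mul_of_nonneg_left (abs_abs_sub_abs_le _ _) (hk0 e))
      (by linarith)
  have hCS : (∑ e ∈ E, k e * |h (e.1 + unitv d e.2) - h e.1|) ^ 2 ≤
      (∑ e ∈ E, (ω.1 e)⁻¹ * k e ^ 2) * D := by
    refine Finset.sum_sq_le_sum_mul_sum_of_sq_le_mul E
      (fun e _ => mul_nonneg (inv_nonneg.2 (ω.2 e).le) (sq_nonneg _))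
      (fun e _ => mul_nonneg (ω.2 e).le (sq_nonneg _)) fun e _ => le_of_eq ?_
    have := (ω.2 e).ne'
    rw [mul_pow, sq_abs]
    field_simp
  have hHol : ∑ e ∈ E, (ω.1 e)⁻¹ * k e ^ 2 ≤
      W ^ (1 / q) * (∑ e ∈ E, (k e ^ 2) ^ q') ^ (1 / q') := by
    refine (Real.inner_le_Lp_mul_Lq_of_nonneg E hconj
      (fun e _ => inv_nonneg.2 (ω.2 e).le) (fun e _ => sq_nonneg _)).trans_eq ?_
    congr 2
    refine Finset.sum_congr rfl fun e _ => ?_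
    rw [Real.inv_rpow (ω.2 e).le, Real.rpow_neg (ω.2 e).le]
  have hkq : ∀ e, (k e ^ 2) ^ q' ≤
      2 ^ (2 * q') * (|h (e.1 + unitv d e.2)| ^ ρ + |h e.1| ^ ρ) := by
    intro e
    have hr : ∀ t : ℝ, 0 ≤ t → (t ^ (γ - 1)) ^ (2 * q') = t ^ ρ := fun t ht => by
      rw [← Real.rpow_mul ht, mul_comm (γ - 1), hexp]
    have e2 : (k e ^ 2) ^ q' = k e ^ (2 * q') := by
      rw [← Real.rpow_natCast, ← Real.rpow_mul (hk0 e)]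
      norm_num
    set a := |h (e.1 + unitv d e.2)| with ha
    set b := |h e.1| with hb
    have ha0 : 0 ≤ a := abs_nonneg _
    have hb0 : 0 ≤ b := abs_nonneg _
    have e3 : k e ≤ 2 * max (a ^ (γ - 1)) (b ^ (γ - 1)) := by
      have := le_max_left (a ^ (γ - 1)) (b ^ (γ - 1))
      have := le_max_right (a ^ (γ - 1)) (b ^ (γ - 1))
      simp only [hk]
      linarith
    rw [e2]
    have h2q : 0 ≤ 2 * q' := by positivity
    refine (Real.rpow_le_rpow (hk0 e) e3 h2q).trans ?_
    rw [Real.mul_rpow (by norm_num) (by positivity)]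
    refine mul_le_mul_of_nonneg_left ?_ (by positivity)
    have ha1 : 0 ≤ a ^ ρ := by positivity
    have hb1 : 0 ≤ b ^ ρ := by positivity
    rcases max_choice (a ^ (γ - 1)) (b ^ (γ - 1)) with hm | hm <;> rw [hm]
    · rw [hr a ha0]; linarith
    · rw [hr b hb0]; linarith
  have hk2 : ∑ e ∈ E, (k e ^ 2) ^ q' ≤ 2 ^ (2 * q') * (2 * d) * X := by
    have hφ : ∀ x, 0 ≤ |h x| ^ ρ := fun _ => by positivity
    have hφS : ∀ x ∉ S, |h x| ^ ρ = 0 := fun x hx => by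
      rw [hS x hx, abs_zero, Real.zero_rpow hρ0.ne']
    have h1 := sum_fst_le hφ hφS E
    have h2 := sum_snd_le hφ hφS E
    calc _ ≤ ∑ e ∈ E, 2 ^ (2 * q') * (|h (e.1 + unitv d e.2)| ^ ρ + |h e.1| ^ ρ) :=
          Finset.sum_le_sum fun e _ => hkq e
      _ = 2 ^ (2 * q') * (∑ e ∈ E, |h (e.1 + unitv d e.2)| ^ ρ + ∑ e ∈ E, |h e.1| ^ ρ) := by
          rw [← Finset.mul_sum, Finset.sum_add_distrib]
      _ ≤ 2 ^ (2 * q') * (d * X + d * X) := by gcongr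
      _ = _ := by ring
  set M : ℝ := 2 ^ (2 * q') * (2 * d) with hM
  have hM0 : 0 < M := by positivity
  have hfin : (X ^ ((d - 1) / (d : ℝ))) ^ 2 ≤
      γ ^ 2 * (W ^ (1 / q) * (M ^ (1 / q') * X ^ (1 / q'))) * D := by
    have s1 : X ^ ((d - 1) / (d : ℝ)) ≤ G := by
      calc X ^ ((d - 1) / (d : ℝ)) ≤ (G ^ ((d : ℝ) / (d - 1))) ^ ((d - 1) / (d : ℝ)) :=
            Real.rpow_le_rpow hX0 hsob (by positivity)
        _ = G := by
            rw [← Real.rpow_mul hG0]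
            have : (d : ℝ) / (d - 1) * ((d - 1) / d) = 1 := by field_simp
            rw [this, Real.rpow_one]
    have s2 : (∑ e ∈ E, (k e ^ 2) ^ q') ^ (1 / q') ≤ M ^ (1 / q') * X ^ (1 / q') := by
      rw [← Real.mul_rpow hM0.le hX0]
      exact Real.rpow_le_rpow (Finset.sum_nonneg fun e _ => by positivity) hk2 (by positivity)
    calc (X ^ ((d - 1) / (d : ℝ))) ^ 2
        ≤ (γ * ∑ e ∈ E, k e * |h (e.1 + unitv d e.2) - h e.1|) ^ 2 := by
          gcongr
          exact s1.trans hG1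
      _ = γ ^ 2 * (∑ e ∈ E, k e * |h (e.1 + unitv d e.2) - h e.1|) ^ 2 := by ring
      _ ≤ γ ^ 2 * ((W ^ (1 / q) * (M ^ (1 / q') * X ^ (1 / q'))) * D) := by
          refine mul_le_mul_of_nonneg_left (hCS.trans ?_) (by positivity)
          refine mul_le_mul_of_nonneg_right (hHol.trans ?_) hD0
          gcongr
      _ = _ := by ring
  have e4 : (X ^ ((d - 1) / (d : ℝ))) ^ 2 = X ^ (2 / ρ) * X ^ (1 / q') := by
    rw [← Real.rpow_natCast, ← Real.rpow_mul hX0, ← Real.rpow_add hXp, hρq, hinv]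
    congr 1
    push_cast
    field_simp
    ring
  rw [e4] at hfin
  have hXq : 0 < X ^ (1 / q') := by positivity
  refine le_of_mul_le_mul_right (hfin.trans_eq ?_) hXq
  ring

theorem sum_edgesIn_fst {d : ℕ} {S : Finset (Vert d)} {φ : EdgeIx d → ℝ}
    (hφ : ∀ e, e.1 ∉ S → φ e = 0) :
    ∑ e ∈ edgesIn d S, φ e = ∑ x ∈ S, ∑ i, φ (x, i) := by
  rw [← Finset.sum_product']
  refine (Finset.sum_subset (fun e he => ?_) fun e _ he => ?_).symm
  · exact mem_edgesIn.2 (Or.inl (Finset.mem_product.1 he).1)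
  · exact hφ e fun h => he (Finset.mem_product.2 ⟨h, Finset.mem_univ _⟩)

theorem sum_edgesIn_snd {d : ℕ} {S : Finset (Vert d)} {φ : EdgeIx d → ℝ}
    (hφ : ∀ e, e.1 + unitv d e.2 ∉ S → φ e = 0) :
    ∑ e ∈ edgesIn d S, φ e = ∑ x ∈ S, ∑ i, φ (x - unitv d i, i) := by
  rw [← Finset.sum_product' S Finset.univ fun x i => φ (x - unitv d i, i),
    ← Finset.sum_filter_of_ne (p := fun e => e.1 + unitv d e.2 ∈ S)
      fun e _ h => by_contra fun hcon => h (hφ e hcon)]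
  refine Finset.sum_nbij' (fun e => (e.1 + unitv d e.2, e.2)) (fun e => (e.1 - unitv d e.2, e.2))
    ?_ ?_ ?_ ?_ ?_
  · intro e he
    exact Finset.mem_product.2 ⟨(Finset.mem_filter.1 he).2, Finset.mem_univ _⟩
  · intro e he
    have := (Finset.mem_product.1 he).1
    exact Finset.mem_filter.2 ⟨mem_edgesIn.2 (Or.inr (by simpa using this)), by simpa using this⟩
  · intro e _; simp
  · intro e _; simp
  · intro e _; simp

theorem sum_fst_edgesIn_le {d : ℕ} {S : Finset (Vert d)} {φ : EdgeIx d → ℝ}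
    (hφ : ∀ e, 0 ≤ φ e) : ∑ x ∈ S, ∑ i, φ (x, i) ≤ ∑ e ∈ edgesIn d S, φ e := by
  have h := sum_edgesIn_fst (S := S) (φ := fun e => if e.1 ∈ S then φ e else 0)
    fun e he => if_neg he
  calc _ = ∑ e ∈ edgesIn d S, if e.1 ∈ S then φ e else 0 := by
        rw [h]
        exact Finset.sum_congr rfl fun x hx => by simp [hx]
    _ ≤ _ := Finset.sum_le_sum fun e _ => by split_ifs <;> simp [hφ]

theorem sum_snd_edgesIn_le {d : ℕ} {S : Finset (Vert d)} {φ : EdgeIx d → ℝ}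
    (hφ : ∀ e, 0 ≤ φ e) :
    ∑ x ∈ S, ∑ i, φ (x - unitv d i, i) ≤ ∑ e ∈ edgesIn d S, φ e := by
  have h := sum_edgesIn_snd (S := S) (φ := fun e => if e.1 + unitv d e.2 ∈ S then φ e else 0)
    fun e he => if_neg he
  calc _ = ∑ e ∈ edgesIn d S, if e.1 + unitv d e.2 ∈ S then φ e else 0 := by
        rw [h]
        exact Finset.sum_congr rfl fun x hx => by simp [hx]
    _ ≤ _ := Finset.sum_le_sum fun e _ => by split_ifs <;> simp [hφ]

/-- The Dirichlet form of the killed walk as a sum over edges. -/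
theorem sum_edges_eq_wInner {d : ℕ} (hd : 0 < d) (ω : EnvSp d) {S : Finset (Vert d)}
    {h : Vert d → ℝ} (hS : ∀ x ∉ S, h x = 0) :
    ∑ e ∈ edgesIn d S, ω.1 e * (h (e.1 + unitv d e.2) - h e.1) ^ 2 =
      wInner (piOf d ω) S h h -
        wInner (piOf d ω) S (killedOp (piOf d ω) (cnd d ω) S h) h := by
  have h1 : ∑ e ∈ edgesIn d S, ω.1 e * (h (e.1 + unitv d e.2) - h e.1) ^ 2 =
      ∑ e ∈ edgesIn d S, ω.1 e * (h e.1 * (h e.1 - h (e.1 + unitv d e.2))) +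
      ∑ e ∈ edgesIn d S, ω.1 e *
        (h (e.1 + unitv d e.2) * (h (e.1 + unitv d e.2) - h e.1)) := by
    rw [← Finset.sum_add_distrib]
    exact Finset.sum_congr rfl fun e _ => by ring
  rw [h1, sum_edgesIn_fst fun e he => by simp [hS _ he],
    sum_edgesIn_snd fun e he => by simp [hS _ he], wInner, wInner, ← Finset.sum_add_distrib,
    ← Finset.sum_sub_distrib]
  refine Finset.sum_congr rfl fun x _ => ?_
  have h2 : piOf d ω x * killedOp (piOf d ω) (cnd d ω) S h x =
      ∑ i, (ω.1 (x, i) * h (x + unitv d i) + ω.1 (x - unitv d i, i) * h (x - unitv d i)) := by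
    have hpi := (piOf_pos ω hd x).ne'
    have h3 := sum_cnd_mul ω S x h
    rw [killedOp_apply, Finset.mul_sum]
    calc _ = ∑ y ∈ S, cnd d ω x y * h y :=
          Finset.sum_congr rfl fun y _ => by field_simp
      _ = _ := by
          rw [h3]
          refine Finset.sum_congr rfl fun i _ => ?_
          congr 1
          · split_ifs with hm
            · rfl
            · rw [hS _ hm, mul_zero]
          · split_ifs with hm
            · rfl
            · rw [hS _ hm, mul_zero]
  rw [h2, piOf, Finset.sum_mul, Finset.sum_mul, Finset.sum_mul, ← Finset.sum_add_distrib,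
    ← Finset.sum_sub_distrib]
  refine Finset.sum_congr rfl fun i _ => ?_
  simp only [sub_add_cancel]
  ring

/-- Three-factor Hölder inequality for finite sums. -/
theorem sum_rpow_mul_rpow_mul_rpow_le {ι : Type*} (S : Finset ι) {f g k : ι → ℝ}
    (hf : ∀ x, 0 ≤ f x) (hg : ∀ x, 0 ≤ g x) (hk : ∀ x, 0 ≤ k x) {a b e : ℝ}
    (ha : 0 < a) (hb : 0 < b) (he : 0 < e) (habe : a + b + e = 1) :
    ∑ x ∈ S, f x ^ a * g x ^ b * k x ^ e ≤
      (∑ x ∈ S, f x) ^ a * (∑ x ∈ S, g x) ^ b * (∑ x ∈ S, k x) ^ e := by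
  have hz : ∀ φ : ι → ℝ, (∀ x, 0 ≤ φ x) → ∑ x ∈ S, φ x = 0 → ∀ x ∈ S, φ x = 0 :=
    fun φ h0 hs => (Finset.sum_eq_zero_iff_of_nonneg fun x _ => h0 x).1 hs
  rcases (Finset.sum_nonneg fun x (_ : x ∈ S) => hf x).eq_or_lt with h | hZ
  · have := hz f hf h.symm
    rw [Finset.sum_eq_zero fun x hx => by rw [this x hx, Real.zero_rpow ha.ne']; simp, ← h,
      Real.zero_rpow ha.ne']
    simp
  rcases (Finset.sum_nonneg fun x (_ : x ∈ S) => hg x).eq_or_lt with h | hX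
  · have := hz g hg h.symm
    rw [Finset.sum_eq_zero fun x hx => by rw [this x hx, Real.zero_rpow hb.ne']; simp, ← h,
      Real.zero_rpow hb.ne']
    simp
  rcases (Finset.sum_nonneg fun x (_ : x ∈ S) => hk x).eq_or_lt with h | hW
  · have := hz k hk h.symm
    rw [Finset.sum_eq_zero fun x hx => by rw [this x hx, Real.zero_rpow he.ne']; simp, ← h,
      Real.zero_rpow he.ne']
    simp
  set Z := ∑ x ∈ S, f x
  set X := ∑ x ∈ S, g x
  set W := ∑ x ∈ S, k x
  have hP : 0 < Z ^ a * X ^ b * W ^ e := by positivity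
  rw [← div_le_one hP, Finset.sum_div]
  calc ∑ x ∈ S, f x ^ a * g x ^ b * k x ^ e / (Z ^ a * X ^ b * W ^ e)
      ≤ ∑ x ∈ S, (a * (f x / Z) + b * (g x / X) + e * (k x / W)) := by
        refine Finset.sum_le_sum fun x _ => ?_
        have := Real.geom_mean_le_arith_mean3_weighted ha.le hb.le he.le
          (div_nonneg (hf x) hZ.le) (div_nonneg (hg x) hX.le) (div_nonneg (hk x) hW.le) habe
        rw [Real.div_rpow (hf x) hZ.le, Real.div_rpow (hg x) hX.le,
          Real.div_rpow (hk x) hW.le] at this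
        refine le_trans (le_of_eq ?_) this
        field_simp
    _ = 1 := by
        rw [Finset.sum_add_distrib, Finset.sum_add_distrib, ← Finset.mul_sum, ← Finset.mul_sum,
          ← Finset.mul_sum, ← Finset.sum_div, ← Finset.sum_div, ← Finset.sum_div,
          div_self hZ.ne', div_self hX.ne', div_self hW.ne']
        linarith

theorem card_box_le (d N : ℕ) (hN : 1 ≤ N) : ((box d (N : ℝ)).card : ℝ) ≤ 3 ^ d * (N : ℝ) ^ d := by
  have h : (box d (N : ℝ)).card = (2 * N + 1) ^ d := by
    rw [box, Fintype.card_piFinset]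
    have e1 : ⌈-(N : ℝ)⌉ = -(N : ℤ) := by rw [Int.ceil_neg, Int.floor_natCast]
    have e2 : ⌊(N : ℝ)⌋ = (N : ℤ) := Int.floor_natCast N
    simp only [e1, e2, Int.card_Icc, Finset.prod_const, Finset.card_univ, Fintype.card_fin]
    congr 1
    omega
  have hN' : (1 : ℝ) ≤ N := by exact_mod_cast hN
  rw [h, ← mul_pow]
  push_cast
  gcongr
  linarith

/-- Polynomial growth of the moments of `ω` and `π_ω` on boxes. -/
theorem InOmegaPQ.exists_bounds {d : ℕ} {p q : ℝ} {ω : EnvSp d} (hd : 0 < d) (hp : 1 ≤ p)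
    (h : InOmegaPQ d p q ω) :
    ∃ C : ℝ, 0 < C ∧ ∀ N : ℕ, 1 ≤ N →
      ∑ e ∈ edgesIn d (box d (N : ℝ)), ω.1 e ^ (-q) ≤ C * (N : ℝ) ^ d ∧
      ∑ x ∈ box d (N : ℝ), piOf d ω x ^ p ≤ C * (N : ℝ) ^ d ∧
      ∑ x ∈ box d (N : ℝ), piOf d ω x ≤ C * (N : ℝ) ^ d := by
  obtain ⟨⟨C₁, h₁⟩, ⟨C₂, h₂⟩⟩ := h
  set K : ℝ := (d : ℝ) ^ (p - 1) * 2 ^ (p - 1) * 2 with hK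
  have hd' : (0 : ℝ) < d := by exact_mod_cast hd
  have hK0 : 0 < K := by positivity
  refine ⟨|C₂| + K * |C₁| + 3 ^ d, by positivity, fun N hN => ?_⟩
  have hNd : 0 < (N : ℝ) ^ d := by
    have : (0 : ℝ) < N := by exact_mod_cast hN
    positivity
  have b₁ := (div_le_iff₀ hNd).1 (h₁ N hN)
  have b₂ := (div_le_iff₀ hNd).1 (h₂ N hN)
  have b₁' : ∑ e ∈ edgesIn d (box d (N : ℝ)), ω.1 e ^ p ≤ |C₁| * (N : ℝ) ^ d :=
    b₁.trans (mul_le_mul_of_nonneg_right (le_abs_self _) hNd.le)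
  have b₂' : ∑ e ∈ edgesIn d (box d (N : ℝ)), ω.1 e ^ (-q) ≤ |C₂| * (N : ℝ) ^ d :=
    b₂.trans (mul_le_mul_of_nonneg_right (le_abs_self _) hNd.le)
  have hω : ∀ e, 0 ≤ ω.1 e ^ p := fun e => Real.rpow_nonneg (ω.2 e).le _
  have hpi : ∑ x ∈ box d (N : ℝ), piOf d ω x ^ p ≤ K * |C₁| * (N : ℝ) ^ d := by
    calc ∑ x ∈ box d (N : ℝ), piOf d ω x ^ p
        ≤ ∑ x ∈ box d (N : ℝ), (d : ℝ) ^ (p - 1) * (2 ^ (p - 1) *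
            ((∑ i, ω.1 (x, i) ^ p) + ∑ i, ω.1 (x - unitv d i, i) ^ p)) := by
          refine Finset.sum_le_sum fun x _ => ?_
          have := Real.rpow_sum_le_const_mul_sum_rpow_of_nonneg (s := (Finset.univ : Finset (Fin d)))
            (f := fun i => ω.1 (x, i) + ω.1 (x - unitv d i, i)) hp
            (fun i _ => add_nonneg (ω.2 _).le (ω.2 _).le)
          rw [Finset.card_univ, Fintype.card_fin] at this
          refine this.trans (mul_le_mul_of_nonneg_left ?_ (by positivity))
          rw [← Finset.sum_add_distrib, Finset.mul_sum]
          refine Finset.sum_le_sum fun i _ => ?_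
          exact_mod_cast NNReal.rpow_add_le_mul_rpow_add_rpow ⟨_, (ω.2 (x, i)).le⟩
            ⟨_, (ω.2 (x - unitv d i, i)).le⟩ hp
      _ = (d : ℝ) ^ (p - 1) * (2 ^ (p - 1) *
            ((∑ x ∈ box d (N : ℝ), ∑ i, ω.1 (x, i) ^ p) +
              ∑ x ∈ box d (N : ℝ), ∑ i, ω.1 (x - unitv d i, i) ^ p)) := by
          rw [← Finset.mul_sum, ← Finset.mul_sum, Finset.sum_add_distrib]
      _ ≤ (d : ℝ) ^ (p - 1) * (2 ^ (p - 1) *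
            (|C₁| * (N : ℝ) ^ d + |C₁| * (N : ℝ) ^ d)) := by
          gcongr
          · exact (sum_fst_edgesIn_le (φ := fun e => ω.1 e ^ p) hω).trans b₁'
          · exact (sum_snd_edgesIn_le (φ := fun e => ω.1 e ^ p) hω).trans b₁'
      _ = _ := by rw [hK]; ring
  refine ⟨b₂'.trans ?_, hpi.trans ?_, ?_⟩
  · gcongr
    have : 0 < K * |C₁| + 3 ^ d := by positivity
    linarith
  · gcongr
    have : 0 < |C₂| + 3 ^ d := by positivity
    linarith
  · calc ∑ x ∈ box d (N : ℝ), piOf d ω x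
        ≤ ∑ x ∈ box d (N : ℝ), (1 + piOf d ω x ^ p) := by
          refine Finset.sum_le_sum fun x _ => ?_
          have h0 := piOf_pos ω hd x
          rcases le_total (piOf d ω x) 1 with h | h
          · have : 0 ≤ piOf d ω x ^ p := by positivity
            linarith
          · have := Real.rpow_le_rpow_of_exponent_le h hp
            rw [Real.rpow_one] at this
            linarith
      _ ≤ 3 ^ d * (N : ℝ) ^ d + K * |C₁| * (N : ℝ) ^ d := by
          rw [Finset.sum_add_distrib]
          refine add_le_add ?_ hpi
          simpa using card_box_le d N hN
      _ ≤ _ := by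
          rw [← add_mul]
          refine mul_le_mul_of_nonneg_right ?_ hNd.le
          have : 0 ≤ |C₂| := abs_nonneg _
          linarith

/-! ### Nash inequality and on-diagonal heat kernel decay -/

theorem nash_exponent {D a r P Q t A e : ℝ} (ha : 0 < a) (ha1 : a < 1) (ht : t = (2 - a) / 2)
    (hA : A = (2 - a) / a) (he : e = (1 - a) * P) (hQ : D * Q = 2 * r * D - D + 2)
    (hae : a * (1 - P - r) = 1 - P - 2 * r) :
    D / A - 2 = -(D * Q * t + D * e) * (1 / t) := by
  have h2a : 2 - a ≠ 0 := by linarith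
  rw [hQ, hA, ht, he]
  field_simp
  linear_combination (2 * D) * hae

set_option maxHeartbeats 1000000 in
/-- Nash inequality for the killed walk on boxes. -/
theorem InOmegaPQ.exists_nash {d : ℕ} (hd : 2 ≤ d) {p q : ℝ} (hp : (d : ℝ) / 2 < p)
    (hq : (d : ℝ) / 2 < q) (hpq : 1 / p + 1 / q < 2 / (d : ℝ)) {ω : EnvSp d}
    (hω : InOmegaPQ d p q ω) :
    ∃ A c : ℝ, 0 < A ∧ 0 < c ∧ ∀ N : ℕ, 1 ≤ N → ∀ h : Vert d → ℝ,
      ∑ x ∈ box d N, piOf d ω x * |h x| ≤ 2 →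
      c * (N : ℝ) ^ (d / A - 2) * wInner (piOf d ω) (box d N) h h ^ (1 + 1 / A) ≤
        wInner (piOf d ω) (box d N) h h -
          wInner (piOf d ω) (box d N) (killedOp (piOf d ω) (cnd d ω) (box d N) h) h := by
  have hd2 : (2 : ℝ) ≤ d := by exact_mod_cast hd
  have hd0 : 0 < d := by omega
  have hp1 : 1 < p := by linarith
  have hq1 : 1 < q := by linarith
  set P : ℝ := 1 / p with hPd
  set Q : ℝ := 1 / q with hQd
  set r : ℝ := (1 - 2 / d + Q) / 2 with hr
  have hP0 : 0 < P := by positivity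
  have hQ0 : 0 < Q := by positivity
  have h2d : 2 / (d : ℝ) ≤ 1 := by rw [div_le_one (by linarith)]; exact hd2
  have hr0 : 0 < r := by rw [hr]; linarith
  have hr1 : r ≤ 1 / 2 := by rw [hr]; linarith
  have hden : 0 < 1 - P - r := by rw [hr]; linarith
  set a : ℝ := (1 - P - 2 * r) / (1 - P - r) with had
  have ha0 : 0 < a := div_pos (by rw [hr]; linarith) hden
  have ha1 : a < 1 := by rw [had, div_lt_one hden]; linarith
  have hae : a * (1 - P - r) = 1 - P - 2 * r := div_mul_cancel₀ _ hden.ne'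
  set b : ℝ := (2 - a) * r with hbd
  set e : ℝ := (1 - a) * P with hed
  have hb0 : 0 < b := mul_pos (by linarith) hr0
  have he0 : 0 < e := mul_pos (by linarith) hP0
  have habe : a + b + e = 1 := by rw [hbd, hed]; linarith
  set ρ : ℝ := 1 / r with hρ
  have hρ0 : 0 < ρ := by positivity
  have hρ2 : 2 ≤ ρ := by rw [hρ, le_div_iff₀ hr0]; linarith
  have hρr : 2 / ρ = 2 * r := by rw [hρ]; field_simp
  have hbρ : a + ρ * b = 2 := by rw [hbd, hρ]; field_simp; ring
  have hep : a + p * e = 1 := by rw [hed, hPd]; field_simp; ring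
  obtain ⟨C, hC0, hC⟩ := exists_weighted_sobolev hd hq1 hρ2 (by rw [hρr, hr, hQd]; ring)
  obtain ⟨C₁, hC₁0, hC₁⟩ := hω.exists_bounds hd0 hp1.le
  set t : ℝ := (2 - a) / 2 with ht
  have ht0 : 0 < t := by rw [ht]; linarith
  set A : ℝ := (2 - a) / a with hA
  have hA0 : 0 < A := div_pos (by linarith) ha0
  have hAt : 1 + 1 / A = 1 / t := by
    have : 2 - a ≠ 0 := by linarith
    rw [hA, ht]; field_simp; ring
  set K : ℝ := 2 ^ a * (C * C₁ ^ Q) ^ t * C₁ ^ e with hK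
  have hK0 : 0 < K := by positivity
  refine ⟨A, K ^ (-(1 / t)), hA0, by positivity, fun N hN h hZ => ?_⟩
  obtain ⟨hWq, hWp, -⟩ := hC₁ N hN
  have hN0 : (0 : ℝ) < N := by exact_mod_cast hN
  set S := box d (N : ℝ) with hS
  set h' : Vert d → ℝ := fun x => if x ∈ S then h x else 0 with hh'
  have hh : ∀ x ∈ S, h' x = h x := fun x hx => by simp [hh', hx]
  have hoff : ∀ x ∉ S, h' x = 0 := fun x hx => by simp [hh', hx]
  have hD := sum_edges_eq_wInner hd0 ω hoff
  have e1 : wInner (piOf d ω) S h' h' = wInner (piOf d ω) S h h :=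
    Finset.sum_congr rfl fun x hx => by rw [hh x hx]
  have e2 : wInner (piOf d ω) S (killedOp (piOf d ω) (cnd d ω) S h') h' =
      wInner (piOf d ω) S (killedOp (piOf d ω) (cnd d ω) S h) h := by
    refine Finset.sum_congr rfl fun x hx => ?_
    rw [hh x hx, killedOp_apply, killedOp_apply]
    congr 2
    exact Finset.sum_congr rfl fun y hy => by rw [hh y hy]
  rw [e1, e2] at hD
  have hsob := hC ω S h' hoff
  rw [hD] at hsob
  have hD0 : 0 ≤ wInner (piOf d ω) S h h -
      wInner (piOf d ω) S (killedOp (piOf d ω) (cnd d ω) S h) h := by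
    rw [← hD]
    exact Finset.sum_nonneg fun e _ => mul_nonneg (ω.2 e).le (sq_nonneg _)
  set D := wInner (piOf d ω) S h h -
      wInner (piOf d ω) S (killedOp (piOf d ω) (cnd d ω) S h) h with hDd
  set u := wInner (piOf d ω) S h h with hu
  have hu0 : 0 ≤ u := wInner_self_nonneg S (isNetwork_cnd ω hd0) h
  have hpi : ∀ x, 0 ≤ piOf d ω x := fun x => (piOf_pos ω hd0 x).le
  set X := ∑ x ∈ S, |h' x| ^ ρ with hX
  have hX0 : 0 ≤ X := Finset.sum_nonneg fun x _ => by positivity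
  have hX' : ∑ x ∈ S, |h x| ^ ρ = X := Finset.sum_congr rfl fun x hx => by rw [hh x hx]
  have hhol : u ≤ (∑ x ∈ S, piOf d ω x * |h x|) ^ a * X ^ b * (∑ x ∈ S, piOf d ω x ^ p) ^ e := by
    rw [← hX']
    refine le_trans (le_of_eq ?_) (sum_rpow_mul_rpow_mul_rpow_le S
      (fun x => mul_nonneg (hpi x) (abs_nonneg (h x))) (fun x => by positivity)
      (fun x => Real.rpow_nonneg (hpi x) p) ha0 hb0 he0 habe)
    refine Finset.sum_congr rfl fun x _ => ?_
    have f1 : (|h x| ^ ρ) ^ b = |h x| ^ (ρ * b) := by rw [← Real.rpow_mul (abs_nonneg _)]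
    have f2 : (piOf d ω x ^ p) ^ e = piOf d ω x ^ (p * e) := by rw [← Real.rpow_mul (hpi x)]
    have f3 : |h x| ^ a * |h x| ^ (ρ * b) = h x ^ 2 := by
      rw [← Real.rpow_add_of_nonneg (abs_nonneg _) ha0.le (by positivity), hbρ]
      norm_num
    have f4 : piOf d ω x ^ a * piOf d ω x ^ (p * e) = piOf d ω x := by
      rw [← Real.rpow_add_of_nonneg (hpi x) ha0.le (by positivity), hep, Real.rpow_one]
    rw [f1, f2, Real.mul_rpow (hpi x) (abs_nonneg _)]
    calc piOf d ω x * h x * h x = piOf d ω x * h x ^ 2 := by ring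
      _ = (piOf d ω x ^ a * piOf d ω x ^ (p * e)) * (|h x| ^ a * |h x| ^ (ρ * b)) := by
          rw [f3, f4]
      _ = _ := by ring
  have hXb : X ^ b ≤ (C * (C₁ * (N : ℝ) ^ d) ^ Q * D) ^ t := by
    have : X ^ b = (X ^ (2 / ρ)) ^ t := by
      rw [← Real.rpow_mul hX0]
      congr 1
      rw [ht, hρr, hbd]
      ring
    rw [this]
    refine Real.rpow_le_rpow (by positivity) (hsob.trans ?_) ht0.le
    have : 0 ≤ ∑ e ∈ edgesIn d S, ω.1 e ^ (-q) :=
      Finset.sum_nonneg fun e _ => Real.rpow_nonneg (ω.2 e).le _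
    gcongr
  have hfin : u ≤ K * (N : ℝ) ^ (d * Q * t + d * e) * D ^ t := by
    have hZ0 : 0 ≤ ∑ x ∈ S, piOf d ω x * |h x| :=
      Finset.sum_nonneg fun x _ => mul_nonneg (hpi x) (abs_nonneg _)
    have hW0 : 0 ≤ ∑ x ∈ S, piOf d ω x ^ p :=
      Finset.sum_nonneg fun x _ => Real.rpow_nonneg (hpi x) p
    calc u ≤ 2 ^ a * (C * (C₁ * (N : ℝ) ^ d) ^ Q * D) ^ t * (C₁ * (N : ℝ) ^ d) ^ e := by
          refine hhol.trans ?_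
          gcongr
      _ = _ := by
          have hNd : 0 ≤ (N : ℝ) ^ d := by positivity
          have hNQ : 0 ≤ ((N : ℝ) ^ d) ^ Q := by positivity
          have g1 : (((N : ℝ) ^ d) ^ Q) ^ t = (N : ℝ) ^ (d * Q * t) := by
            rw [← Real.rpow_natCast, ← Real.rpow_mul hN0.le, ← Real.rpow_mul hN0.le]
          have g2 : ((N : ℝ) ^ d) ^ e = (N : ℝ) ^ (d * e) := by
            rw [← Real.rpow_natCast, ← Real.rpow_mul hN0.le]
          rw [Real.mul_rpow hC₁0.le hNd, Real.mul_rpow hC₁0.le hNd, ← mul_assoc C,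
            Real.mul_rpow (by positivity) hD0, Real.mul_rpow (by positivity) hNQ, g1, g2,
            Real.rpow_add hN0, hK]
          ring
  have hexp : (d / A - 2 : ℝ) = -(d * Q * t + d * e) * (1 / t) := by
    have hQr : d * Q = 2 * r * d - d + 2 := by rw [hr]; field_simp; ring
    exact nash_exponent ha0 ha1 ht hA hed hQr hae
  have hu1 := Real.rpow_le_rpow hu0 hfin (by positivity : 0 ≤ 1 / t)
  have hDt : (D ^ t) ^ (1 / t) = D := by
    rw [← Real.rpow_mul hD0, mul_one_div_cancel ht0.ne', Real.rpow_one]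
  rw [Real.mul_rpow (by positivity) (by positivity), hDt, Real.mul_rpow hK0.le (by positivity),
    ← Real.rpow_mul hN0.le] at hu1
  rw [hAt, hexp]
  calc K ^ (-(1 / t)) * (N : ℝ) ^ (-(d * Q * t + d * e) * (1 / t)) * u ^ (1 / t)
      ≤ K ^ (-(1 / t)) * (N : ℝ) ^ (-(d * Q * t + d * e) * (1 / t)) *
        (K ^ (1 / t) * (N : ℝ) ^ ((d * Q * t + d * e) * (1 / t)) * D) := by gcongr
    _ = (K ^ (-(1 / t)) * K ^ (1 / t)) * ((N : ℝ) ^ (-(d * Q * t + d * e) * (1 / t)) *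
        (N : ℝ) ^ ((d * Q * t + d * e) * (1 / t))) * D := by ring
    _ = D := by
        rw [← Real.rpow_add hK0, ← Real.rpow_add hN0, neg_mul, neg_add_cancel, neg_add_cancel,
          Real.rpow_zero, Real.rpow_zero, one_mul, one_mul]

theorem le_rpow_of_sub_ge {u : ℕ → ℝ} {κ A : ℝ} (hA : 0 < A) (hκ : 0 < κ) (hu : ∀ m, 0 ≤ u m)
    (h : ∀ m, κ * u m ^ (1 + 1 / A) ≤ u m - u (m + 1)) {m : ℕ} (hm : 1 ≤ m) :
    u m ≤ (κ / A * m) ^ (-A) := by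
  have hm0 : (0 : ℝ) < m := by exact_mod_cast hm
  have hR : 0 < (κ / A * m) ^ (-A) := by positivity
  rcases (hu m).eq_or_lt with h0 | h0
  · rw [← h0]; exact hR.le
  have hanti : Antitone u := antitone_nat_of_succ_le fun k => by
    have : 0 ≤ κ * u k ^ (1 + 1 / A) := mul_nonneg hκ.le (Real.rpow_nonneg (hu k) _)
    linarith [h k]
  have key : ∀ j ≤ m, κ / A * j ≤ u j ^ (-(1 / A)) := by
    intro j
    induction j with
    | zero => intro _; simp [Real.rpow_nonneg (hu 0)]
    | succ j ih =>
      intro hj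
      have hj0 : 0 < u j := h0.trans_le (hanti (by omega))
      have hj1 : 0 < u (j + 1) := h0.trans_le (hanti hj)
      have ih' := ih (by omega)
      have hle : u (j + 1) ≤ u j * Real.exp (-(κ * u j ^ (1 / A))) := by
        have h1 := h j
        rw [Real.rpow_add hj0, Real.rpow_one] at h1
        have h2 := Real.add_one_le_exp (-(κ * u j ^ (1 / A)))
        nlinarith
      have h3 : (u j * Real.exp (-(κ * u j ^ (1 / A)))) ^ (-(1 / A)) ≤ u (j + 1) ^ (-(1 / A)) :=
        Real.rpow_le_rpow_of_nonpos hj1 hle (by simp [hA.le])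
      rw [Real.mul_rpow hj0.le (Real.exp_pos _).le, ← Real.exp_mul] at h3
      have h4 := Real.add_one_le_exp (-(κ * u j ^ (1 / A)) * -(1 / A))
      have h5 : u j ^ (-(1 / A)) * u j ^ (1 / A) = 1 := by
        rw [← Real.rpow_add hj0]; simp
      have h6 : 0 < u j ^ (-(1 / A)) := by positivity
      have h7 := mul_le_mul_of_nonneg_left h4 h6.le
      push_cast
      have h8 : u j ^ (-(1 / A)) * (-(κ * u j ^ (1 / A)) * -(1 / A) + 1) =
          κ / A * (u j ^ (-(1 / A)) * u j ^ (1 / A)) + u j ^ (-(1 / A)) := by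
        field_simp
      rw [h8, h5] at h7
      linarith
  have hk := key m le_rfl
  have hpos : 0 < κ / A * m := by positivity
  have := Real.rpow_le_rpow_of_nonpos hpos hk (by linarith : -A ≤ 0)
  rw [← Real.rpow_mul (hu m)] at this
  have e : -(1 / A) * -A = 1 := by field_simp
  rwa [e, Real.rpow_one] at this

section Density

variable {V : Type*} {w : V → ℝ} {c : V → V → ℝ} (S : Finset V)

/-- The density of the unit point mass at `z` with respect to the weight `w`. -/
def pointDensity [DecidableEq V] (w : V → ℝ) (z : V) : V → ℝ := fun y => if y = z then (w z)⁻¹ else 0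

theorem wInner_pointDensity [DecidableEq V] (H : IsNetwork w c) {z : V} (hz : z ∈ S) (f : V → ℝ) :
    wInner w S (pointDensity w z) f = f z := by
  have : w z ≠ 0 := (H.pos z).ne'
  rw [wInner, Finset.sum_eq_single_of_mem z hz fun y _ hy => by simp [pointDensity, hy]]
  simp [pointDensity, this]

theorem killedOp_pow_nonneg (H : IsNetwork w c) {f : V → ℝ} (hf : ∀ x, 0 ≤ f x) (k : ℕ) (x : V) :
    0 ≤ (killedOp w c S ^ k) f x := by
  induction k generalizing x with
  | zero => exact hf x
  | succ k ih =>
    rw [pow_succ']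
    exact Finset.sum_nonneg fun y _ =>
      mul_nonneg (div_nonneg (H.nonneg _ _) (H.pos _).le) (ih y)

theorem wInner_killedOp_pow_symm (H : IsNetwork w c) (k : ℕ) (f g : V → ℝ) :
    wInner w S ((killedOp w c S ^ k) f) g = wInner w S f ((killedOp w c S ^ k) g) := by
  induction k generalizing f g with
  | zero => rfl
  | succ k ih =>
    rw [pow_succ]
    change wInner w S ((killedOp w c S ^ k) (killedOp w c S f)) g = _
    rw [ih, wInner_killedOp_symm S H, ← pow_succ]
    rw [pow_succ']
    rfl

theorem sum_mul_killedOp_pow_le (H : IsNetwork w c) {f : V → ℝ} (hf : ∀ x, 0 ≤ f x) (k : ℕ) :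
    ∑ x ∈ S, w x * (killedOp w c S ^ k) f x ≤ ∑ x ∈ S, w x * f x := by
  induction k with
  | zero => exact le_rfl
  | succ k ih =>
    refine le_trans ?_ ih
    set g := (killedOp w c S ^ k) f with hg
    have hg0 : ∀ x, 0 ≤ g x := killedOp_pow_nonneg S H hf k
    have e : (killedOp w c S ^ (k + 1)) f = killedOp w c S g := by rw [pow_succ']; rfl
    rw [e]
    calc ∑ x ∈ S, w x * killedOp w c S g x = ∑ x ∈ S, ∑ y ∈ S, c x y * g y := by
          refine Finset.sum_congr rfl fun x _ => ?_
          have := (H.pos x).ne'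
          rw [killedOp_apply, Finset.mul_sum]
          exact Finset.sum_congr rfl fun y _ => by field_simp
      _ = ∑ y ∈ S, (∑ x ∈ S, c y x) * g y := by
          rw [Finset.sum_comm]
          refine Finset.sum_congr rfl fun y _ => ?_
          rw [Finset.sum_mul]
          exact Finset.sum_congr rfl fun x _ => by rw [H.symm]
      _ ≤ _ := Finset.sum_le_sum fun y _ => mul_le_mul_of_nonneg_right (H.sum_le S y) (hg0 y)

theorem wInner_le_half (H : IsNetwork w c) (f g : V → ℝ) :
    wInner w S f g ≤ (wInner w S f f + wInner w S g g) / 2 := by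
  have := wInner_self_nonneg S H (f - g)
  rw [wInner_sub_left, wInner_sub_right, wInner_sub_right, wInner_comm S g f] at this
  linarith

end Density

theorem InOmegaPQ.exists_heat_bound {d : ℕ} (hd : 2 ≤ d) {p q : ℝ} (hp : (d : ℝ) / 2 < p)
    (hq : (d : ℝ) / 2 < q) (hpq : 1 / p + 1 / q < 2 / (d : ℝ)) {ω : EnvSp d}
    (hω : InOmegaPQ d p q ω) :
    ∃ A C : ℝ, 0 < A ∧ 0 < C ∧ ∀ N : ℕ, 1 ≤ N → ∀ k : ℕ, 2 ≤ k → ∀ z ∈ box d N, ∀ x ∈ box d N,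
      (killedOp (piOf d ω) (cnd d ω) (box d N) ^ k) (pointDensity (piOf d ω) z) x ≤
        C * (((N : ℝ) ^ 2 / k) ^ A * ((N : ℝ) ^ d)⁻¹) := by
  obtain ⟨A, c, hA, hc, hN⟩ := hω.exists_nash hd hp hq hpq
  have hd0 : 0 < d := by omega
  have H := isNetwork_cnd ω hd0
  refine ⟨A, (c / 2 / A / 3) ^ (-A), hA, by positivity, fun N hN1 k hk z hz x hx => ?_⟩
  have hN0 : (0 : ℝ) < N := by exact_mod_cast hN1
  set S := box d (N : ℝ) with hS
  set Q := killedOp (piOf d ω) (cnd d ω) S with hQ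
  have key : ∀ y ∈ S, ∀ m : ℕ, 1 ≤ m →
      wInner (piOf d ω) S ((Q ^ m) (pointDensity (piOf d ω) y))
        ((Q ^ m) (pointDensity (piOf d ω) y)) ≤
      (c / 2 * (N : ℝ) ^ (d / A - 2) / A * m) ^ (-A) := by
    intro y hy m hm
    have hδ : ∀ x, 0 ≤ pointDensity (piOf d ω) y x := fun x => by
      unfold pointDensity
      split_ifs
      · exact inv_nonneg.2 (H.pos _).le
      · exact le_rfl
    have hsum1 : ∑ x ∈ S, piOf d ω x * pointDensity (piOf d ω) y x = 1 := by
      have := wInner_pointDensity S H hy (fun _ => 1)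
      simpa [wInner] using this
    refine le_rpow_of_sub_ge (u := fun m => wInner (piOf d ω) S
      ((Q ^ m) (pointDensity (piOf d ω) y)) ((Q ^ m) (pointDensity (piOf d ω) y)))
      hA (by positivity) (fun m => wInner_self_nonneg S H _) (fun m => ?_) hm
    set g := (Q ^ m) (pointDensity (piOf d ω) y) with hg
    have hg1 : (Q ^ (m + 1)) (pointDensity (piOf d ω) y) = Q g := by rw [pow_succ']; rfl
    have hg0 : ∀ x, 0 ≤ g x := killedOp_pow_nonneg S H hδ m
    have hQg0 : ∀ x, 0 ≤ Q g x := fun x => by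
      rw [← hg1]; exact killedOp_pow_nonneg S H hδ (m + 1) x
    have hZ : ∑ x ∈ S, piOf d ω x * |(g + Q g) x| ≤ 2 := by
      have h1 := sum_mul_killedOp_pow_le S H hδ m
      have h2 := sum_mul_killedOp_pow_le S H hδ (m + 1)
      rw [← hQ, hg1] at h2
      rw [hsum1] at h1 h2
      calc _ = ∑ x ∈ S, piOf d ω x * g x + ∑ x ∈ S, piOf d ω x * Q g x := by
            rw [← Finset.sum_add_distrib]
            refine Finset.sum_congr rfl fun x _ => ?_
            rw [Pi.add_apply, abs_of_nonneg (add_nonneg (hg0 x) (hQg0 x)), mul_add]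
        _ ≤ 1 + 1 := add_le_add h1 h2
        _ = 2 := by norm_num
    have h1 := hN N hN1 (g + Q g) hZ
    have h2 := dirichlet_add_le S H g
    have h3 : wInner (piOf d ω) S g g ≤ wInner (piOf d ω) S (g + Q g) (g + Q g) :=
      Finset.sum_le_sum fun x _ => by
        have := (H.pos x).le
        simp only [Pi.add_apply]
        have := hg0 x
        have := hQg0 x
        gcongr <;> linarith
    have h4 : wInner (piOf d ω) S g g ^ (1 + 1 / A) ≤
        wInner (piOf d ω) S (g + Q g) (g + Q g) ^ (1 + 1 / A) :=
      Real.rpow_le_rpow (wInner_self_nonneg S H g) h3 (by positivity)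
    have h5 := mul_le_mul_of_nonneg_left h4 (by positivity : 0 ≤ c * (N : ℝ) ^ (d / A - 2))
    simp only [hg1]
    linarith
  have hk0 : (0 : ℝ) < k := by exact_mod_cast (by omega : 0 < k)
  have mono : ∀ m : ℕ, k ≤ 3 * m →
      (c / 2 * (N : ℝ) ^ (d / A - 2) / A * m) ^ (-A) ≤
        (c / 2 * (N : ℝ) ^ (d / A - 2) / A * (k / 3)) ^ (-A) := by
    intro m hm
    have hm' : (k : ℝ) ≤ 3 * m := by exact_mod_cast hm
    refine Real.rpow_le_rpow_of_nonpos (by positivity) ?_ (by linarith)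
    gcongr
    linarith
  have hi : 1 ≤ k / 2 := by omega
  have hj : 1 ≤ k - k / 2 := by omega
  have b1 := (key x hx _ hi).trans (mono _ (by omega))
  have b2 := (key z hz _ hj).trans (mono _ (by omega))
  have e1 : (Q ^ k) (pointDensity (piOf d ω) z) x =
      wInner (piOf d ω) S ((Q ^ (k / 2)) (pointDensity (piOf d ω) x))
        ((Q ^ (k - k / 2)) (pointDensity (piOf d ω) z)) := by
    rw [hQ, wInner_killedOp_pow_symm S H, wInner_pointDensity S H hx, ← hQ]
    change _ = (Q ^ (k / 2) * Q ^ (k - k / 2)) _ x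
    rw [← pow_add, Nat.add_sub_cancel' (Nat.div_le_self k 2)]
  rw [e1]
  refine (wInner_le_half S H _ _).trans ?_
  have e2 : (c / 2 * (N : ℝ) ^ (d / A - 2) / A * (k / 3)) ^ (-A) =
      (c / 2 / A / 3) ^ (-A) * (((N : ℝ) ^ 2 / k) ^ A * ((N : ℝ) ^ d)⁻¹) := by
    rw [show c / 2 * (N : ℝ) ^ (d / A - 2) / A * (k / 3) =
      (c / 2 / A / 3) * ((N : ℝ) ^ (d / A - 2) * k) by ring,
      Real.mul_rpow (by positivity) (by positivity), Real.mul_rpow (by positivity) (by positivity),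
      ← Real.rpow_mul hN0.le, Real.div_rpow (by positivity) hk0.le, Real.rpow_neg hk0.le,
      ← Real.rpow_natCast, ← Real.rpow_natCast, ← Real.rpow_mul hN0.le,
      show ((d : ℝ) / A - 2) * -A = ((2 : ℕ) : ℝ) * A + -(d : ℝ) by push_cast; field_simp; ring,
      Real.rpow_add hN0, Real.rpow_neg hN0.le (d : ℝ)]
    ring
  linarith

/-! ### Markov property of the walk -/

/-- The event `H` only depends on the trajectory up to time `k`. -/
def AdaptedAt {d : ℕ} (k : ℕ) (H : Set (Path d)) : Prop :=
  ∀ w w' : Path d, (∀ j ≤ k, w j = w' j) → w ∈ H → w' ∈ H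

section Markov

variable {d : ℕ} {k : ℕ} {H : Set (Path d)}

theorem AdaptedAt.inter {H' : Set (Path d)} (h : AdaptedAt k H) (h' : AdaptedAt k H') :
    AdaptedAt k (H ∩ H') :=
  fun w w' hw hm => ⟨h w w' hw hm.1, h' w w' hw hm.2⟩

theorem AdaptedAt.mono {l : ℕ} (h : AdaptedAt k H) (hkl : k ≤ l) : AdaptedAt l H :=
  fun w w' hw => h w w' fun j hj => hw j (hj.trans hkl)

theorem adaptedAt_eval {j : ℕ} (hj : j ≤ k) (p : Vert d → Prop) :
    AdaptedAt k {w : Path d | p (w j)} :=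
  fun w w' hw hm => by
    change p (w' j)
    rw [← hw j hj]
    exact hm

theorem adaptedAt_forall_mem (S : Finset (Vert d)) :
    AdaptedAt k {w : Path d | ∀ j ≤ k, w j ∈ S} :=
  fun w w' hw hm j hj => by
    rw [← hw j hj]
    exact hm j hj

theorem measurable_initial (k : ℕ) :
    Measurable fun (w : Path d) (i : Fin (k + 1)) => w i :=
  measurable_pi_iff.2 fun _ => measurable_pi_apply _

theorem AdaptedAt.eq_preimage (h : AdaptedAt k H) :
    H = (fun (w : Path d) (i : Fin (k + 1)) => w i) ⁻¹'
      ((fun (w : Path d) (i : Fin (k + 1)) => w i) '' H) := by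
  refine Set.Subset.antisymm (Set.subset_preimage_image _ _) ?_
  rintro w ⟨w', hw', he⟩
  exact h w' w (fun j hj => congrFun he ⟨j, by omega⟩) hw'

theorem AdaptedAt.measurableSet (h : AdaptedAt k H) : MeasurableSet H := by
  rw [h.eq_preimage]
  exact measurable_initial k (Set.to_countable _).measurableSet

theorem measurableSet_eval (j : ℕ) (p : Vert d → Prop) : MeasurableSet {w : Path d | p (w j)} :=
  (adaptedAt_eval le_rfl p).measurableSet

variable {ω : EnvSp d} {x₀ : Vert d} {μ : Measure (Path d)}

/-- One-step Markov property. -/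
theorem IsWalkLaw.measure_step (hμ : IsWalkLaw d ω x₀ μ) (h : AdaptedAt k H) (x y : Vert d) :
    μ (H ∩ {w | w k = x} ∩ {w | w (k + 1) = y}) =
      μ (H ∩ {w | w k = x}) * ENNReal.ofReal (transP d ω x y) := by
  set r : Path d → (Fin (k + 1) → Vert d) := fun w i => w i with hr
  have hrm : Measurable r := measurable_initial k
  have hmx : MeasurableSet {w : Path d | w k = x} := measurableSet_eval k (· = x)
  have hmy : MeasurableSet {w : Path d | w (k + 1) = y} := measurableSet_eval (k + 1) (· = y)
  have key : (μ.restrict ({w | w k = x} ∩ {w | w (k + 1) = y})).map r =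
      ENNReal.ofReal (transP d ω x y) • (μ.restrict {w | w k = x}).map r := by
    refine Measure.ext_of_singleton fun γ => ?_
    have hs : MeasurableSet (r ⁻¹' {γ}) := hrm (measurableSet_singleton γ)
    rw [Measure.smul_apply, Measure.map_apply hrm (measurableSet_singleton γ),
      Measure.map_apply hrm (measurableSet_singleton γ), Measure.restrict_apply hs,
      Measure.restrict_apply hs, smul_eq_mul]
    by_cases hγ : γ (Fin.last k) = x
    · set γ' : ℕ → Vert d := fun j => if hj : j < k + 1 then γ ⟨j, hj⟩ else y with hγ'
      have hγ'k : γ' k = x := by simp [hγ', ← hγ, Fin.last]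
      have hγ'y : γ' (k + 1) = y := by simp [hγ']
      have hmem : ∀ w : Path d, r w = γ ↔ ∀ j ≤ k, w j = γ' j := by
        intro w
        constructor
        · rintro rfl j hj
          simp only [hγ', hr]
          rw [dif_pos (by omega)]
        · intro hw
          funext ⟨j, hj⟩
          have h1 := hw j (by omega)
          simp only [hγ'] at h1
          rw [dif_pos hj] at h1
          exact h1
      have s1 : r ⁻¹' {γ} ∩ ({w | w k = x} ∩ {w | w (k + 1) = y}) =
          {w | ∀ j ≤ k + 1, w j = γ' j} := by
        ext w
        simp only [Set.mem_inter_iff, Set.mem_preimage, Set.mem_singleton_iff, Set.mem_ofPred_eq,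
          hmem]
        constructor
        · rintro ⟨h1, -, h2⟩ j hj
          rcases Nat.lt_or_ge k j with hj' | hj'
          · obtain rfl : j = k + 1 := by omega
            rw [h2, hγ'y]
          · exact h1 j hj'
        · intro hw
          exact ⟨fun j hj => hw j (by omega), (hw k (by omega)).trans hγ'k,
            (hw (k + 1) le_rfl).trans hγ'y⟩
      have s2 : r ⁻¹' {γ} ∩ {w | w k = x} = {w | ∀ j ≤ k, w j = γ' j} := by
        ext w
        simp only [Set.mem_inter_iff, Set.mem_preimage, Set.mem_singleton_iff, Set.mem_ofPred_eq,
          hmem]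
        exact ⟨fun h => h.1, fun hw => ⟨hw, (hw k le_rfl).trans hγ'k⟩⟩
      rw [s1, s2, hμ.2, hμ.2, Finset.prod_range_succ, hγ'k, hγ'y]
      ring
    · have hem : r ⁻¹' {γ} ∩ {w | w k = x} = ∅ := by
        ext w
        simp only [Set.mem_inter_iff, Set.mem_preimage, Set.mem_singleton_iff, Set.mem_ofPred_eq,
          Set.mem_empty_iff_false, iff_false, not_and]
        rintro rfl h
        exact hγ h
      rw [← Set.inter_assoc, hem]
      simp
  have hB : MeasurableSet (r '' H) := (Set.to_countable _).measurableSet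
  have := congrArg (fun ν => ν (r '' H)) key
  simp only [Measure.smul_apply, smul_eq_mul] at this
  rw [Measure.map_apply hrm hB, Measure.map_apply hrm hB, ← h.eq_preimage,
    Measure.restrict_apply h.measurableSet, Measure.restrict_apply h.measurableSet,
    ← Set.inter_assoc] at this
  rw [this, mul_comm]

theorem transP_nonneg (hd : 0 < d) (x y : Vert d) : 0 ≤ transP d ω x y :=
  div_nonneg (cnd_nonneg ω x y) (piOf_pos ω hd x).le

theorem IsWalkLaw.measureReal_step (hd : 0 < d) (hμ : IsWalkLaw d ω x₀ μ) (h : AdaptedAt k H)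
    (x y : Vert d) :
    μ.real (H ∩ {w | w k = x} ∩ {w | w (k + 1) = y}) =
      μ.real (H ∩ {w | w k = x}) * transP d ω x y := by
  rw [measureReal_def, hμ.measure_step h, ENNReal.toReal_mul,
    ENNReal.toReal_ofReal (transP_nonneg hd x y)]
  rfl

theorem measureReal_inter_mem [IsProbabilityMeasure μ] (H : Set (Path d))
    (hH : MeasurableSet H) (j : ℕ) (G : Finset (Vert d)) :
    μ.real (H ∩ {w | w j ∈ G}) = ∑ y ∈ G, μ.real (H ∩ {w | w j = y}) := by
  rw [← measureReal_biUnion_finset]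
  · congr 1
    ext w
    simp
  · intro y _ z _ hyz
    refine Set.disjoint_left.2 ?_
    rintro w ⟨-, h1⟩ ⟨-, h2⟩
    exact hyz (h1.symm.trans h2)
  · exact fun y _ => hH.inter (measurableSet_eval j (· = y))

theorem IsWalkLaw.measureReal_stay (hd : 0 < d) (hμ : IsWalkLaw d ω x₀ μ) (G : Finset (Vert d))
    (m : ℕ) : ∀ (k : ℕ) (H : Set (Path d)), AdaptedAt k H → ∀ x : Vert d,
      μ.real (H ∩ {w | w k = x} ∩ {w | ∀ j, 1 ≤ j → j ≤ m → w (k + j) ∈ G}) =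
        μ.real (H ∩ {w | w k = x}) *
          (killedOp (piOf d ω) (cnd d ω) G ^ m) (fun _ => 1) x := by
  have := hμ.1
  induction m with
  | zero =>
    intro k H hH x
    have : {w : Path d | ∀ j, 1 ≤ j → j ≤ 0 → w (k + j) ∈ G} = Set.univ := by
      ext w
      simp only [Set.mem_ofPred_eq, Set.mem_univ, iff_true]
      intro j h1 h2
      omega
    rw [this, Set.inter_univ]
    simp
  | succ m ih =>
    intro k H hH x
    set H' := H ∩ {w : Path d | w k = x} with hH'
    have hH'a : AdaptedAt (k + 1) H' :=
      (hH.inter (adaptedAt_eval le_rfl (· = x))).mono (Nat.le_succ k)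
    have hstay : MeasurableSet {w : Path d | ∀ j, 1 ≤ j → j ≤ m → w (k + 1 + j) ∈ G} := by
      simp only [Set.ofPred_forall]
      exact MeasurableSet.iInter fun j => MeasurableSet.iInter fun _ => MeasurableSet.iInter
        fun _ => measurableSet_eval _ (· ∈ G)
    have e : H' ∩ {w | ∀ j, 1 ≤ j → j ≤ m + 1 → w (k + j) ∈ G} =
        (H' ∩ {w | ∀ j, 1 ≤ j → j ≤ m → w (k + 1 + j) ∈ G}) ∩ {w | w (k + 1) ∈ G} := by
      ext w
      simp only [Set.mem_inter_iff, Set.mem_ofPred_eq]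
      constructor
      · rintro ⟨h1, h2⟩
        exact ⟨⟨h1, fun j hj hjm => by
          have := h2 (1 + j) (by omega) (by omega)
          rwa [← add_assoc] at this⟩, h2 1 le_rfl (by omega)⟩
      · rintro ⟨⟨h1, h2⟩, h3⟩
        refine ⟨h1, fun j hj hjm => ?_⟩
        rcases Nat.lt_or_ge 1 j with hj' | hj'
        · have := h2 (j - 1) (by omega) (by omega)
          rwa [show k + 1 + (j - 1) = k + j by omega] at this
        · obtain rfl : j = 1 := by omega
          exact h3
    rw [e, measureReal_inter_mem _ (hH'a.measurableSet.inter hstay), pow_succ']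
    change _ = _ * killedOp (piOf d ω) (cnd d ω) G
      ((killedOp (piOf d ω) (cnd d ω) G ^ m) fun _ => 1) x
    rw [killedOp_apply, Finset.mul_sum]
    refine Finset.sum_congr rfl fun y _ => ?_
    rw [Set.inter_right_comm, ih (k + 1) H' hH'a y, hμ.measureReal_step hd hH, mul_assoc]
    rfl

/-- Probability of leaving `G` within `m` steps after time `k`. -/
theorem IsWalkLaw.measureReal_exit (hd : 0 < d) (hμ : IsWalkLaw d ω x₀ μ) (G : Finset (Vert d))
    (m : ℕ) (hH : AdaptedAt k H) (x : Vert d) :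
    μ.real (H ∩ {w | w k = x} ∩ {w | ∃ j, 1 ≤ j ∧ j ≤ m ∧ w (k + j) ∉ G}) =
      μ.real (H ∩ {w | w k = x}) *
        (1 - (killedOp (piOf d ω) (cnd d ω) G ^ m) (fun _ => 1) x) := by
  have := hμ.1
  have hstay : MeasurableSet {w : Path d | ∀ j, 1 ≤ j → j ≤ m → w (k + j) ∈ G} := by
    simp only [Set.ofPred_forall]
    exact MeasurableSet.iInter fun j => MeasurableSet.iInter fun _ => MeasurableSet.iInter
      fun _ => measurableSet_eval _ (· ∈ G)
  have h1 := hμ.measureReal_stay hd G m k H hH x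
  have h2 := measureReal_inter_add_sdiff (μ := μ) (s := H ∩ {w | w k = x}) hstay
  have e : H ∩ {w | w k = x} ∩ {w | ∃ j, 1 ≤ j ∧ j ≤ m ∧ w (k + j) ∉ G} =
      (H ∩ {w | w k = x}) \ {w | ∀ j, 1 ≤ j → j ≤ m → w (k + j) ∈ G} := by
    ext w
    simp
  rw [e]
  linarith

/-- The law at time `k` of the walk killed upon leaving `S`. -/
theorem IsWalkLaw.measureReal_killed (hd : 0 < d) (hμ : IsWalkLaw d ω x₀ μ)
    {S : Finset (Vert d)} (k : ℕ) : ∀ x ∈ S,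
    μ.real ({w | ∀ j ≤ k, w j ∈ S} ∩ {w | w k = x}) =
      piOf d ω x * (killedOp (piOf d ω) (cnd d ω) S ^ k) (pointDensity (piOf d ω) x₀) x := by
  have := hμ.1
  induction k with
  | zero =>
    intro x hx
    have h := hμ.2 0 (fun _ => x)
    have e : {w : Path d | ∀ j ≤ 0, w j ∈ S} ∩ {w | w 0 = x} = {w | ∀ j ≤ 0, w j = x} := by
      ext w
      simp only [Set.mem_inter_iff, Set.mem_ofPred_eq, Nat.le_zero, forall_eq]
      exact ⟨fun h => h.2, fun h => ⟨h ▸ hx, h⟩⟩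
    rw [e, measureReal_def, h]
    have := (piOf_pos ω hd x).ne'
    by_cases hxx : x = x₀
    · subst hxx
      simp [pointDensity, this]
    · simp [pointDensity, hxx]
  | succ k ih =>
    intro x hx
    have e : {w : Path d | ∀ j ≤ k + 1, w j ∈ S} ∩ {w | w (k + 1) = x} =
        ({w | ∀ j ≤ k, w j ∈ S} ∩ {w | w (k + 1) = x}) ∩ {w | w k ∈ S} := by
      ext w
      simp only [Set.mem_inter_iff, Set.mem_ofPred_eq]
      constructor
      · rintro ⟨h1, h2⟩
        exact ⟨⟨fun j hj => h1 j (by omega), h2⟩, h1 k (by omega)⟩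
      · rintro ⟨⟨h1, h2⟩, -⟩
        refine ⟨fun j hj => ?_, h2⟩
        rcases Nat.lt_or_ge k j with hj' | hj'
        · obtain rfl : j = k + 1 := by omega
          rwa [h2]
        · exact h1 j hj'
    rw [e, measureReal_inter_mem _ ((adaptedAt_forall_mem S).measurableSet.inter
      (measurableSet_eval _ (· = x))), pow_succ']
    change _ = _ * killedOp (piOf d ω) (cnd d ω) S
      ((killedOp (piOf d ω) (cnd d ω) S ^ k) (pointDensity (piOf d ω) x₀)) x
    rw [killedOp_apply, Finset.mul_sum]
    refine Finset.sum_congr rfl fun y hy => ?_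
    rw [Set.inter_right_comm, hμ.measureReal_step hd (adaptedAt_forall_mem S), ih y hy, transP,
      cnd_comm]
    have := (piOf_pos ω hd x).ne'
    have := (piOf_pos ω hd y).ne'
    field_simp

end Markov

/-! ### Probability of a large displacement over a block of time -/

theorem killedOp_pow_one_le_one {V : Type*} {w : V → ℝ} {c : V → V → ℝ} (S : Finset V)
    (H : IsNetwork w c) (m : ℕ) (x : V) : (killedOp w c S ^ m) (fun _ => 1) x ≤ 1 := by
  induction m generalizing x with
  | zero => exact le_rfl
  | succ m ih =>
    rw [pow_succ']
    change killedOp w c S ((killedOp w c S ^ m) fun _ => 1) x ≤ 1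
    rw [killedOp_apply]
    calc _ ≤ ∑ y ∈ S, c x y / w x :=
          Finset.sum_le_sum fun y _ => mul_le_of_le_one_right
            (div_nonneg (H.nonneg x y) (H.pos x).le) (ih y)
      _ ≤ 1 := by
          rw [← Finset.sum_div, div_le_one (H.pos x)]
          exact H.sum_le S x

section Block

variable {d : ℕ} {p q : ℝ} {ω : EnvSp d} {μ : Measure (Path d)}

theorem measureReal_ne_zero_start (hμ : IsWalkLaw d ω 0 μ) : μ.real {w | w 0 ≠ 0} = 0 := by
  have := hμ.1
  have h := hμ.2 0 fun _ => 0
  have e : {w : Path d | ∀ k ≤ 0, w k = 0} = {w | w 0 = 0} := by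
    ext w
    simp
  rw [e] at h
  have e' : {w : Path d | w 0 ≠ 0} = {w | w 0 = 0}ᶜ := rfl
  rw [e', measureReal_compl (measurableSet_eval 0 (· = 0)), measureReal_def, measureReal_def, h]
  simp

/-- Bound on the probability of starting a time interval `(k, k + m]` in a set `F` and leaving
during it a set `G` that contains all points at distance at most `L` from `F`. -/
def HasBlockBound (μ : Measure (Path d)) (A : ℝ) (B : ℕ) (K : ℝ) : Prop :=
  ∀ N k m : ℕ, 1 ≤ N → 2 ≤ k → 1 ≤ m →
    ∀ L : ℝ, 0 < L → ∀ F G : Finset (Vert d), G ⊆ box d N → (∀ x ∈ F, cube d x L ⊆ G) →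
      μ.real ({w | ∀ j ≤ k, w j ∈ box d N} ∩ {w | w k ∈ F} ∩
          {w | ∃ j, 1 ≤ j ∧ j ≤ m ∧ w (k + j) ∉ G}) ≤
        K * (((N : ℝ) ^ 2 / k) ^ A * (m / L ^ 2) ^ B)

theorem InOmegaPQ.exists_block_bound (hω : InOmegaPQ d p q ω) (hd : 2 ≤ d)
    (hp : (d : ℝ) / 2 < p) (hq : (d : ℝ) / 2 < q) (hpq : 1 / p + 1 / q < 2 / (d : ℝ))
    (hμ : IsWalkLaw d ω 0 μ) :
    ∃ A : ℝ, 0 < A ∧ ∀ B : ℕ, ∃ K : ℝ, 0 < K ∧ HasBlockBound μ A B K := by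
  have := hμ.1
  have hd0 : 0 < d := by omega
  have hp1 : 1 ≤ p := by
    have : (2 : ℝ) ≤ d := by exact_mod_cast hd
    linarith
  obtain ⟨A, C, hA, hC, hheat⟩ := hω.exists_heat_bound hd hp hq hpq
  obtain ⟨C', hC', hvol⟩ := hω.exists_bounds hd0 hp1
  have H := isNetwork_cnd ω hd0
  refine ⟨A, hA, fun B => ⟨C * (4 * (B.factorial * 2 ^ B)) * C', by positivity, ?_⟩⟩
  intro N k m hN hk hm L hL F G hG hF
  have hN0 : (0 : ℝ) < N := by exact_mod_cast hN
  set S := box d (N : ℝ) with hS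
  have hFS : F ⊆ S := fun x hx => hG (hF x hx (mem_cube.2 fun i => by simpa using hL.le))
  have h0S : (0 : Vert d) ∈ S := mem_box.2 fun i => by simp
  have had := adaptedAt_forall_mem (d := d) (k := k) S
  have hexit : MeasurableSet {w : Path d | ∃ j, 1 ≤ j ∧ j ≤ m ∧ w (k + j) ∉ G} := by
    have : {w : Path d | ∃ j, 1 ≤ j ∧ j ≤ m ∧ w (k + j) ∉ G} =
        ⋃ j, ⋃ (_ : 1 ≤ j), ⋃ (_ : j ≤ m), {w | w (k + j) ∉ G} := by
      ext w
      simp only [Set.mem_iUnion, Set.mem_ofPred_eq, exists_prop]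
    rw [this]
    exact MeasurableSet.iUnion fun j => MeasurableSet.iUnion fun _ => MeasurableSet.iUnion
      fun _ => measurableSet_eval _ (· ∉ G)
  set Q := fun x => (killedOp (piOf d ω) (cnd d ω) G ^ m) (fun _ => 1) x with hQ
  set b := C * (((N : ℝ) ^ 2 / k) ^ A * ((N : ℝ) ^ d)⁻¹) with hb
  have hb0 : 0 ≤ b := by positivity
  rw [Set.inter_right_comm, measureReal_inter_mem _ (had.measurableSet.inter hexit)]
  calc ∑ x ∈ F, μ.real ({w | ∀ j ≤ k, w j ∈ S} ∩ {w | ∃ j, 1 ≤ j ∧ j ≤ m ∧ w (k + j) ∉ G} ∩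
          {w | w k = x})
      ≤ ∑ x ∈ F, b * (piOf d ω x * (1 - Q x)) := by
        refine Finset.sum_le_sum fun x hx => ?_
        rw [Set.inter_right_comm, hμ.measureReal_exit hd0 G m had,
          hμ.measureReal_killed hd0 k x (hFS hx)]
        have h1 : 0 ≤ 1 - Q x := sub_nonneg.2 (killedOp_pow_one_le_one G H m x)
        have h2 := hheat N hN k hk 0 h0S x (hFS hx)
        have h3 := (piOf_pos ω hd0 x).le
        calc _ = (killedOp (piOf d ω) (cnd d ω) S ^ k) (pointDensity (piOf d ω) 0) x *
              (piOf d ω x * (1 - Q x)) := by ring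
          _ ≤ _ := mul_le_mul_of_nonneg_right h2 (mul_nonneg h3 h1)
    _ ≤ b * (4 * (B.factorial * (2 * m / L ^ 2) ^ B) * ∑ x ∈ G, piOf d ω x) := by
        rw [← Finset.mul_sum]
        exact mul_le_mul_of_nonneg_left (sum_exit_le ω hd0 hL hF hm B) hb0
    _ ≤ b * (4 * (B.factorial * (2 * m / L ^ 2) ^ B) * (C' * (N : ℝ) ^ d)) := by
        gcongr
        exact (Finset.sum_le_sum_of_subset_of_nonneg hG
          fun x _ _ => (piOf_pos ω hd0 x).le).trans (hvol N hN).2.2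
    _ = _ := by
        have e : (2 * (m : ℝ) / L ^ 2) ^ B = 2 ^ B * (m / L ^ 2) ^ B := by
          rw [mul_div_assoc, mul_pow]
        rw [hb, e]
        field_simp

/-- Bound on the exit time from a cube centred at the starting point. -/
theorem HasBlockBound.exists_initial_bound (hd0 : 0 < d) (hμ : IsWalkLaw d ω 0 μ) {A : ℝ}
    (hA : 0 < A) {B : ℕ} (hB : (2 : ℝ) ^ A * (200 / 243) ^ B ≤ 1 / 2) {K : ℝ} (hK : 0 < K)
    (hblock : HasBlockBound μ A B K) :
    ∃ K' : ℝ, 0 < K' ∧ ∀ N m : ℕ, 1 ≤ N → 1 ≤ m → ∀ R : ℝ, 0 < R → R ≤ N →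
      μ.real {w | w 0 = 0 ∧ ∃ j ≤ m, w j ∉ box d R} ≤
        K' * (((N : ℝ) ^ 2 / m) ^ A * (m / R ^ 2) ^ B) := by
  have := hμ.1
  refine ⟨2 * (K * (2 ^ A * 100 ^ B)) + 3 ^ A * 9 ^ B, by positivity, fun N m hN => ?_⟩
  have hN1 : (1 : ℝ) ≤ N := by exact_mod_cast hN
  set K' := 2 * (K * ((2 : ℝ) ^ A * 100 ^ B)) + 3 ^ A * 9 ^ B with hK'
  have hK'0 : 0 < K' := by positivity
  induction m using Nat.strong_induction_on with
  | _ m ih =>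
  intro hm R hR hRN
  have hm1 : (1 : ℝ) ≤ m := by exact_mod_cast hm
  rcases Nat.lt_or_ge m 4 with hm4 | hm4
  · have hm3 : (m : ℝ) ≤ 3 := by exact_mod_cast (show m ≤ 3 by omega)
    rcases lt_or_ge R 3 with hR3 | hR3
    · have h1 : (1 : ℝ) / 3 ≤ (N : ℝ) ^ 2 / m := by
        rw [div_le_div_iff₀ (by norm_num) (by positivity)]
        nlinarith
      have h2 : (1 : ℝ) / 9 ≤ m / R ^ 2 := by
        rw [div_le_div_iff₀ (by norm_num) (by positivity)]
        nlinarith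
      calc _ ≤ (1 : ℝ) := measureReal_le_one
        _ = (3 ^ A * 9 ^ B) * ((1 / 3) ^ A * (1 / 9) ^ B) := by
            rw [Real.div_rpow (by norm_num) (by norm_num), div_pow]
            simp only [Real.one_rpow, one_pow]
            field_simp
        _ ≤ K' * (((N : ℝ) ^ 2 / m) ^ A * (m / R ^ 2) ^ B) := by
            gcongr
            rw [hK']
            have : 0 < 2 * (K * ((2 : ℝ) ^ A * 100 ^ B)) := by positivity
            linarith
    · have h := hμ.measureReal_exit hd0 (box d R) m (k := 0) (H := Set.univ)
        (fun _ _ _ _ => trivial) 0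
      rw [killedOp_pow_one_apply ω hd0 m 0 (by rw [cube_zero, ← cube_zero, ← cube_zero]
                                               exact cube_mono (hm3.trans hR3)),
        sub_self, mul_zero] at h
      have hle : μ.real {w | w 0 = 0 ∧ ∃ j ≤ m, w j ∉ box d R} ≤ 0 := by
        rw [← h]
        refine measureReal_mono ?_
        rintro w ⟨h0, j, hj, hw⟩
        refine ⟨⟨trivial, h0⟩, j, ?_, hj, by simpa using hw⟩
        rcases Nat.eq_zero_or_pos j with rfl | hj0
        · rw [h0] at hw
          exact absurd (mem_box.2 fun i => by simpa using hR.le) hw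
        · exact hj0
      exact hle.trans (by positivity)
  · set m' := (m + 1) / 2 with hm'
    have hm'2 : 2 ≤ m' := by omega
    have hlow : (m : ℝ) / 2 ≤ m' := by
      have : m ≤ 2 * m' := by omega
      have : (m : ℝ) ≤ 2 * m' := by exact_mod_cast this
      linarith
    have hupp : (m' : ℝ) ≤ 2 / 3 * m := by
      have : 3 * m' ≤ 2 * m := by omega
      have : 3 * (m' : ℝ) ≤ 2 * m := by exact_mod_cast this
      linarith
    have hm'0 : (0 : ℝ) < m' := by linarith
    set Φ := ((N : ℝ) ^ 2 / m) ^ A * (m / R ^ 2) ^ B with hΦ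
    have hpow : ((N : ℝ) ^ 2 / m') ^ A ≤ 2 ^ A * ((N : ℝ) ^ 2 / m) ^ A := by
      rw [← Real.mul_rpow (by norm_num) (by positivity)]
      refine Real.rpow_le_rpow (by positivity) ?_ hA.le
      rw [mul_div_assoc', div_le_div_iff₀ hm'0 (by positivity)]
      nlinarith [sq_nonneg (N : ℝ)]
    have hbox : box d R ⊆ box d N := by
      rw [← cube_zero, ← cube_zero]
      exact cube_mono hRN
    have h1 : μ.real {w | w 0 = 0 ∧ ∃ j ≤ m', w j ∉ box d (9 / 10 * R)} ≤ K' / 2 * Φ := by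
      refine (ih m' (by omega) (by omega) (9 / 10 * R) (by positivity) (by linarith)).trans ?_
      have e : (m' : ℝ) / (9 / 10 * R) ^ 2 ≤ 200 / 243 * (m / R ^ 2) := by
        rw [mul_div_assoc', div_le_div_iff₀ (by positivity) (by positivity)]
        nlinarith [sq_nonneg R]
      calc K' * (((N : ℝ) ^ 2 / m') ^ A * (m' / (9 / 10 * R) ^ 2) ^ B)
          ≤ K' * ((2 ^ A * ((N : ℝ) ^ 2 / m) ^ A) * (200 / 243 * (m / R ^ 2)) ^ B) := by gcongr
        _ = K' * Φ * ((2 : ℝ) ^ A * (200 / 243) ^ B) := by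
            rw [mul_pow, hΦ]
            ring
        _ ≤ K' * Φ * (1 / 2) := by gcongr
        _ = K' / 2 * Φ := by ring
    have h2 := hblock N m' (m - m') hN hm'2 (by omega) (1 / 10 * R) (by positivity)
      (box d (9 / 10 * R)) (box d R) hbox (fun x hx => by
        rw [← cube_zero]
        exact cube_subset_cube (fun i => by simpa using mem_box.1 hx i) (by linarith))
    have h2' : K * (((N : ℝ) ^ 2 / m') ^ A * (((m - m' : ℕ) : ℝ) / (1 / 10 * R) ^ 2) ^ B) ≤
        K' / 2 * Φ := by
      have e : ((m - m' : ℕ) : ℝ) / (1 / 10 * R) ^ 2 ≤ 100 * (m / R ^ 2) := by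
        have : ((m - m' : ℕ) : ℝ) ≤ m := by exact_mod_cast Nat.sub_le _ _
        rw [mul_div_assoc', div_le_div_iff₀ (by positivity) (by positivity)]
        nlinarith [sq_nonneg R]
      calc _ ≤ K * ((2 ^ A * ((N : ℝ) ^ 2 / m) ^ A) * (100 * (m / R ^ 2)) ^ B) := by gcongr
        _ = (K * ((2 : ℝ) ^ A * 100 ^ B)) * Φ := by
            rw [mul_pow, hΦ]
            ring
        _ ≤ K' / 2 * Φ := by
            have : 0 < (3 : ℝ) ^ A * 9 ^ B := by positivity
            gcongr
            linarith
    calc _ ≤ μ.real ({w | w 0 = 0 ∧ ∃ j ≤ m', w j ∉ box d (9 / 10 * R)} ∪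
          ({w | ∀ j ≤ m', w j ∈ box d N} ∩ {w | w m' ∈ box d (9 / 10 * R)} ∩
            {w | ∃ j, 1 ≤ j ∧ j ≤ m - m' ∧ w (m' + j) ∉ box d R})) := by
          refine measureReal_mono ?_
          rintro w ⟨h0, j, hj, hw⟩
          by_cases hw' : ∃ j ≤ m', w j ∉ box d (9 / 10 * R)
          · exact Or.inl ⟨h0, hw'⟩
          · push Not at hw'
            have hR' : box d (9 / 10 * R) ⊆ box d R := by
              rw [← cube_zero, ← cube_zero]
              exact cube_mono (by linarith)
            have hjm : m' < j := by
              by_contra hcon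
              exact hw (hR' (hw' j (by omega)))
            refine Or.inr ⟨⟨fun i hi => hbox (hR' (hw' i hi)), hw' m' le_rfl⟩, j - m', by omega,
              by omega, ?_⟩
            rwa [show m' + (j - m') = j by omega]
      _ ≤ K' / 2 * Φ + K' / 2 * Φ := (measureReal_union_le _ _).trans (add_le_add h1 (h2.trans h2'))
      _ = K' * Φ := by ring

end Block

/-! ### From oscillations to displacements over blocks -/

theorem abs_lineMap_sub_le {a b y r θ : ℝ} (h0 : 0 ≤ θ) (h1 : θ ≤ 1) (ha : |a - y| ≤ r)
    (hb : |b - y| ≤ r) : |a + θ * (b - a) - y| ≤ r := by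
  rw [abs_le] at *
  constructor <;> nlinarith

/-- If the linear interpolation of a sequence oscillates by more than `r`, so does the sequence. -/
theorem exists_abs_sub_gt_of_interpolation {f : ℕ → ℝ} {u v r : ℝ} (hu : 0 ≤ u) (hv : 0 ≤ v)
    (h : r < |(f ⌊u⌋₊ + (u - ⌊u⌋₊) * (f (⌊u⌋₊ + 1) - f ⌊u⌋₊)) -
      (f ⌊v⌋₊ + (v - ⌊v⌋₊) * (f (⌊v⌋₊ + 1) - f ⌊v⌋₊))|) :
    ∃ k l : ℕ, (k = ⌊u⌋₊ ∨ k = ⌊u⌋₊ + 1) ∧ (l = ⌊v⌋₊ ∨ l = ⌊v⌋₊ + 1) ∧ r < |f k - f l| := by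
  by_contra! hcon
  refine absurd h (not_lt.2 ?_)
  have hu0 := sub_nonneg.2 (Nat.floor_le hu)
  have hv0 := sub_nonneg.2 (Nat.floor_le hv)
  have hu1 : u - ⌊u⌋₊ ≤ 1 := by linarith [Nat.lt_floor_add_one u]
  have hv1 : v - ⌊v⌋₊ ≤ 1 := by linarith [Nat.lt_floor_add_one v]
  have key : ∀ k, (k = ⌊u⌋₊ ∨ k = ⌊u⌋₊ + 1) →
      |f k - (f ⌊v⌋₊ + (v - ⌊v⌋₊) * (f (⌊v⌋₊ + 1) - f ⌊v⌋₊))| ≤ r := fun k hk => by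
    rw [abs_sub_comm]
    exact abs_lineMap_sub_le hv0 hv1 (by rw [abs_sub_comm]; exact hcon k _ hk (Or.inl rfl))
      (by rw [abs_sub_comm]; exact hcon k _ hk (Or.inr rfl))
  exact abs_lineMap_sub_le hu0 hu1 (key _ (Or.inl rfl)) (key _ (Or.inr rfl))

/-- A displacement larger than `2 * r` over a time at most `M` is seen as a displacement
larger than `r` within one of the blocks `[j * M, j * M + 2 * M]`. -/
theorem exists_block_abs_sub_gt {f : ℕ → ℝ} {k l M : ℕ} {r : ℝ} (hr : 0 ≤ r) (hM : 1 ≤ M)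
    (hkl : k ≤ l + M) (hlk : l ≤ k + M) (h : 2 * r < |f k - f l|) :
    ∃ j i : ℕ, j * M ≤ k ∧ 1 ≤ i ∧ i ≤ 2 * M ∧ r < |f (j * M + i) - f (j * M)| := by
  set j := min k l / M with hj
  have h1 : j * M ≤ min k l := Nat.div_mul_le_self _ _
  have h2 : min k l < j * M + M := by
    have := Nat.lt_div_mul_add (a := min k l) (b := M) hM
    omega
  have hex : ∃ i ≤ 2 * M, r < |f (j * M + i) - f (j * M)| := by
    by_contra! hcon
    have hk := hcon (k - j * M) (by omega)
    have hl := hcon (l - j * M) (by omega)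
    rw [show j * M + (k - j * M) = k by omega] at hk
    rw [show j * M + (l - j * M) = l by omega] at hl
    rw [abs_le] at hk hl
    refine absurd h (not_lt.2 (abs_le.2 ⟨?_, ?_⟩)) <;> linarith
  obtain ⟨i, hi, hlt⟩ := hex
  refine ⟨j, i, by omega, ?_, hi, hlt⟩
  rcases Nat.eq_zero_or_pos i with rfl | hi0
  · simp only [add_zero, sub_self, abs_zero] at hlt
    exact absurd hlt (not_lt.2 hr)
  · exact hi0

theorem exists_block_of_osc {d n : ℕ} {w : Path d} {ε T δ : ℝ} (hε : 0 < ε)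
    (hδ : 0 < δ) (hn : 1 / δ < n) {s t : ℝ} (hs : s ∈ Set.Icc (0 : ℝ) T)
    (ht : t ∈ Set.Icc (0 : ℝ) T) (hst : |t - s| < δ)
    (h : ε < ‖BnProc d n w t - BnProc d n w s‖) :
    ∃ j i : ℕ, ((j * ⌈3 * δ * n⌉₊ : ℕ) : ℝ) ≤ T * n + 1 ∧ 1 ≤ i ∧ i ≤ 2 * ⌈3 * δ * n⌉₊ ∧
      w (j * ⌈3 * δ * n⌉₊ + i) ∉ cube d (w (j * ⌈3 * δ * n⌉₊)) (ε * √n / 2) := by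
  have hn0 : (0 : ℝ) < n := (by positivity : (0 : ℝ) < 1 / δ).trans hn
  have hδn : 1 < δ * n := by
    rw [div_lt_iff₀ hδ] at hn
    linarith
  have hsq : 0 < √(n : ℝ) := Real.sqrt_pos.2 hn0
  have hcoord : ∃ a : Fin d, ε < |(BnProc d n w t - BnProc d n w s) a| := by
    by_contra! hcon
    exact absurd h (not_lt.2 ((pi_norm_le_iff_of_nonneg hε.le).2 hcon))
  obtain ⟨a, ha⟩ := hcoord
  have hu : 0 ≤ t * n := mul_nonneg ht.1 hn0.le
  have hv : 0 ≤ s * n := mul_nonneg hs.1 hn0.le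
  obtain ⟨k, l, hk, hl, hkl⟩ := exists_abs_sub_gt_of_interpolation
    (f := fun j => (w j a : ℝ)) (r := ε * √n) hu hv (by
      rw [← div_lt_div_iff_of_pos_right hsq, mul_div_cancel_right₀ _ hsq.ne']
      refine ha.trans_eq ?_
      rw [← abs_of_pos hsq, ← abs_div]
      congr 1
      simp only [BnProc, ivert, Pi.sub_apply, Pi.smul_apply, Pi.add_apply, smul_eq_mul]
      field_simp)
  have hfu := Nat.floor_le hu
  have hfv := Nat.floor_le hv
  have hfu' := Nat.lt_floor_add_one (t * n)
  have hfv' := Nat.lt_floor_add_one (s * n)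
  have hdiff : |t * n - s * n| < δ * n := by
    rw [← sub_mul, abs_mul, abs_of_pos hn0]
    exact mul_lt_mul_of_pos_right hst hn0
  rw [abs_lt] at hdiff
  have hM := Nat.le_ceil (3 * δ * n)
  have hkr : (⌊t * n⌋₊ : ℝ) ≤ k ∧ (k : ℝ) ≤ ⌊t * n⌋₊ + 1 := by
    rcases hk with rfl | rfl
    · constructor <;> linarith
    · push_cast
      constructor <;> linarith
  have hlr : (⌊s * n⌋₊ : ℝ) ≤ l ∧ (l : ℝ) ≤ ⌊s * n⌋₊ + 1 := by
    rcases hl with rfl | rfl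
    · constructor <;> linarith
    · push_cast
      constructor <;> linarith
  have hkT : (k : ℝ) ≤ T * n + 1 := by
    have := mul_le_mul_of_nonneg_right ht.2 hn0.le
    linarith
  obtain ⟨j, i, h1, h2, h3, h4⟩ := exists_block_abs_sub_gt (f := fun j => (w j a : ℝ))
    (k := k) (l := l) (M := ⌈3 * δ * n⌉₊) (r := ε * √n / 2) (by positivity)
    (Nat.one_le_ceil_iff.2 (by positivity))
    (by
      have : (k : ℝ) ≤ l + ⌈3 * δ * n⌉₊ := by linarith
      exact_mod_cast this)
    (by
      have : (l : ℝ) ≤ k + ⌈3 * δ * n⌉₊ := by linarith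
      exact_mod_cast this)
    (by linarith)
  refine ⟨j, i, (by exact_mod_cast h1 : ((j * ⌈3 * δ * n⌉₊ : ℕ) : ℝ) ≤ k).trans hkT, h2, h3,
    fun hmem => ?_⟩
  exact absurd (mem_cube.1 hmem a) (not_le.2 h4)

section Cells

variable {d : ℕ} {μ : Measure (Path d)}

/-- Bound on the probability of a displacement larger than `2 * L` over a block of time. -/
theorem HasBlockBound.displacement_le [IsProbabilityMeasure μ] {A K : ℝ} {B : ℕ}
    (hblock : HasBlockBound μ A B K) {N k m : ℕ} (hN : 1 ≤ N) (hk : 2 ≤ k) (hm : 1 ≤ m)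
    {R L Z : ℝ} (hL : 0 < L) (hRL : R + L ≤ N) (hZ : R / L + 1 ≤ Z) :
    μ.real {w | (∀ j ≤ k, w j ∈ box d R) ∧
        ∃ i, 1 ≤ i ∧ i ≤ m ∧ w (k + i) ∉ cube d (w k) (2 * L)} ≤
      (box d Z).card * (K * (((N : ℝ) ^ 2 / k) ^ A * (m / L ^ 2) ^ B)) := by
  classical
  set φ : Vert d → Vert d := fun x i => ⌊(x i : ℝ) / L⌋ with hφ
  set F : Vert d → Finset (Vert d) := fun z => (box d R).filter fun x => φ x = z with hF
  set G : Vert d → Finset (Vert d) := fun z => (F z).biUnion fun x => cube d x L with hG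
  have hRN : box d R ⊆ box d N := by
    rw [← cube_zero, ← cube_zero]
    exact cube_mono (by linarith)
  have hGN : ∀ z, G z ⊆ box d N := fun z => by
    refine Finset.biUnion_subset.2 fun x hx => ?_
    rw [← cube_zero]
    exact cube_subset_cube (t := R)
      (fun i => by simpa using mem_box.1 (Finset.mem_filter.1 hx).1 i) (by linarith)
  have hGF : ∀ y ∈ box d R, G (φ y) ⊆ cube d y (2 * L) := fun y hy => by
    refine Finset.biUnion_subset.2 fun x hx => ?_
    refine cube_subset_cube (t := L) (fun i => ?_) (by linarith)
    have h1 : ⌊(x i : ℝ) / L⌋ = ⌊(y i : ℝ) / L⌋ := congrFun (Finset.mem_filter.1 hx).2 i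
    have h2 := Int.abs_sub_lt_one_of_floor_eq_floor h1
    rw [← sub_div, abs_div, abs_of_pos hL, div_lt_one hL] at h2
    exact h2.le
  have hφZ : ∀ y ∈ box d R, φ y ∈ box d Z := fun y hy => mem_box.2 fun i => by
    have h1 : |(y i : ℝ) / L| ≤ R / L := by
      rw [abs_div, abs_of_pos hL]
      exact div_le_div_of_nonneg_right (mem_box.1 hy i) hL.le
    have h2 := Int.floor_le ((y i : ℝ) / L)
    have h3 := Int.lt_floor_add_one ((y i : ℝ) / L)
    rw [abs_le] at h1 ⊢
    constructor <;> simp only [hφ] <;> linarith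
  calc _ ≤ μ.real (⋃ z ∈ box d Z, ({w | ∀ j ≤ k, w j ∈ box d N} ∩ {w | w k ∈ F z} ∩
          {w | ∃ j, 1 ≤ j ∧ j ≤ m ∧ w (k + j) ∉ G z})) := by
        refine measureReal_mono ?_ (measure_ne_top _ _)
        rintro w ⟨hw, i, h1, h2, h3⟩
        have hwk := hw k le_rfl
        simp only [Set.mem_iUnion]
        exact ⟨φ (w k), hφZ _ hwk, ⟨⟨fun j hj => hRN (hw j hj),
          Finset.mem_filter.2 ⟨hwk, rfl⟩⟩, i, h1, h2, fun hmem => h3 (hGF _ hwk hmem)⟩⟩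
    _ ≤ ∑ z ∈ box d Z, μ.real ({w | ∀ j ≤ k, w j ∈ box d N} ∩ {w | w k ∈ F z} ∩
          {w | ∃ j, 1 ≤ j ∧ j ≤ m ∧ w (k + j) ∉ G z}) := measureReal_biUnion_finset_le _ _
    _ ≤ ∑ _z ∈ box d Z, K * (((N : ℝ) ^ 2 / k) ^ A * (m / L ^ 2) ^ B) :=
        Finset.sum_le_sum fun z _ => hblock N k m hN hk hm L hL (F z) (G z) (hGN z)
          fun x hx => Finset.subset_biUnion_of_mem (fun x => cube d x L) hx
    _ = _ := by rw [Finset.sum_const, nsmul_eq_mul]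

end Cells

/-- The oscillation bound for real-valued measures and small `δ`. -/
theorem measureReal_osc_le {d : ℕ} {μ : Measure (Path d)} {ω : EnvSp d} (hμ : IsWalkLaw d ω 0 μ)
    {A K K' : ℝ} {B : ℕ} (hA : 0 < A) (hAB : A + 2 ≤ B) (hK : 0 < K) (hK' : 0 < K')
    (hblock : HasBlockBound μ A B K)
    (hinit : ∀ N m : ℕ, 1 ≤ N → 1 ≤ m → ∀ R : ℝ, 0 < R → R ≤ N →
      μ.real {w | w 0 = 0 ∧ ∃ j ≤ m, w j ∉ box d R} ≤
        K' * (((N : ℝ) ^ 2 / m) ^ A * (m / R ^ 2) ^ B))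
    {ε T : ℝ} (hε : 0 < ε) (hT : 1 ≤ T) :
    ∃ c : ℝ, 0 < c ∧ ∀ δ : ℝ, 0 < δ → δ ≤ 1 → ∀ n : ℕ, 1 / δ < (n : ℝ) →
      μ.real {w | (∃ s t : ℝ, s ∈ Set.Icc (0 : ℝ) T ∧ t ∈ Set.Icc (0 : ℝ) T ∧ |t - s| < δ ∧
          ε < ‖BnProc d n w t - BnProc d n w s‖) ∧
        ∀ k : ℕ, (k : ℝ) ≤ 3 * T * n → w k ∈ box d (√n / ε)} ≤ c * √δ := by
  have := hμ.1
  set κ := 1 / ε + ε with hκ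
  have hκ0 : 0 < κ := by positivity
  set D := ((κ + 1) ^ 2) ^ A * (128 / ε ^ 2) ^ B with hD
  have hD0 : 0 < D := by positivity
  set Z := 4 / ε ^ 2 + 1 with hZ
  refine ⟨(K' + T * ((box d Z).card * K)) * D, by positivity, fun δ hδ hδ1 n hn => ?_⟩
  have hn0 : (0 : ℝ) < n := (by positivity : (0 : ℝ) < 1 / δ).trans hn
  have hn1 : (1 : ℝ) ≤ n := by exact_mod_cast Nat.cast_pos.1 hn0
  have hδn : 1 < δ * n := by
    rw [div_lt_iff₀ hδ] at hn
    linarith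
  set ν := √(n : ℝ) with hν
  have hν1 : 1 ≤ ν := Real.one_le_sqrt.2 hn1
  have hνn : ν ^ 2 = n := Real.sq_sqrt hn0.le
  set M := ⌈3 * δ * n⌉₊ with hM
  have hMl : 3 * δ * n ≤ M := Nat.le_ceil _
  have hMu : (M : ℝ) ≤ 4 * (δ * n) := by
    have := Nat.ceil_lt_add_one (show 0 ≤ 3 * δ * n by positivity)
    linarith
  have hM0 : (0 : ℝ) < M := by linarith
  have hM2 : 2 ≤ M := by
    have : (2 : ℝ) ≤ M := by linarith
    exact_mod_cast this
  set N := ⌈κ * ν⌉₊ with hN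
  have hNl : κ * ν ≤ N := Nat.le_ceil _
  have hNu : (N : ℝ) ≤ (κ + 1) * ν := by
    have := Nat.ceil_lt_add_one (show 0 ≤ κ * ν by positivity)
    linarith
  have hN1 : 1 ≤ N := Nat.one_le_ceil_iff.2 (by positivity)
  set L := ε * ν / 4 with hL
  have hL0 : 0 < L := by positivity
  have hRL : ν / ε + L ≤ N := by
    refine le_trans ?_ hNl
    have : κ * ν = ν / ε + ε * ν := by rw [hκ]; ring
    have : 0 < ε * ν := by positivity
    linarith
  have hRZ : ν / ε / L + 1 ≤ Z := by
    rw [hZ, hL]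
    refine le_of_eq ?_
    field_simp
  have hΦ : ∀ (k : ℕ) (ρ : ℝ), M ≤ k → L ≤ ρ →
      ((N : ℝ) ^ 2 / k) ^ A * (((2 * M : ℕ) : ℝ) / ρ ^ 2) ^ B ≤ D * δ ^ 2 := by
    intro k ρ hk hρ
    have hk' : (M : ℝ) ≤ k := by exact_mod_cast hk
    have h1 : (N : ℝ) ^ 2 / k ≤ (κ + 1) ^ 2 / δ := by
      rw [div_le_div_iff₀ (by linarith) hδ]
      calc (N : ℝ) ^ 2 * δ ≤ ((κ + 1) * ν) ^ 2 * δ := by gcongr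
        _ = (κ + 1) ^ 2 * (δ * n) := by rw [mul_pow, hνn]; ring
        _ ≤ (κ + 1) ^ 2 * k := by
            gcongr
            linarith
    have h2 : ((2 * M : ℕ) : ℝ) / ρ ^ 2 ≤ 128 / ε ^ 2 * δ := by
      have h3 : ((2 * M : ℕ) : ℝ) ≤ 8 * (δ * n) := by
        push_cast
        linarith
      calc ((2 * M : ℕ) : ℝ) / ρ ^ 2 ≤ (8 * (δ * n)) / L ^ 2 := by gcongr
        _ = 128 / ε ^ 2 * δ := by
            rw [hL, div_pow, mul_pow, hνn]
            field_simp
            norm_num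
    calc _ ≤ ((κ + 1) ^ 2 / δ) ^ A * (128 / ε ^ 2 * δ) ^ B := by gcongr
      _ = D * (δ ^ B / δ ^ A) := by
          rw [Real.div_rpow (by positivity) hδ.le, mul_pow, hD]
          ring
      _ ≤ D * δ ^ 2 := by
          rw [← Real.rpow_natCast δ B, ← Real.rpow_sub hδ, ← Real.rpow_natCast δ 2]
          exact mul_le_mul_of_nonneg_left
            (Real.rpow_le_rpow_of_exponent_ge hδ hδ1 (by push_cast; linarith)) hD0.le
  set J := ⌊T / δ⌋₊ with hJ
  have hJT : (J : ℝ) ≤ T / δ := Nat.floor_le (by positivity)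
  set V : ℕ → Set (Path d) := fun j => {w | (∀ i ≤ j * M, w i ∈ box d (ν / ε)) ∧
    ∃ i, 1 ≤ i ∧ i ≤ 2 * M ∧ w (j * M + i) ∉ cube d (w (j * M)) (2 * L)} with hV
  have hblk : ∀ j ∈ Finset.Icc 1 J, μ.real (V j) ≤ (box d Z).card * (K * (D * δ ^ 2)) := by
    intro j hj
    have hjM : M ≤ j * M := Nat.le_mul_of_pos_left M (Finset.mem_Icc.1 hj).1
    refine (hblock.displacement_le hN1 (hM2.trans hjM) (by omega) hL0 hRL hRZ).trans ?_
    exact mul_le_mul_of_nonneg_left (mul_le_mul_of_nonneg_left (hΦ _ _ hjM le_rfl) hK.le)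
      (Nat.cast_nonneg _)
  have hini : μ.real {w | w 0 = 0 ∧ ∃ j ≤ 2 * M, w j ∉ box d (2 * L)} ≤ K' * (D * δ ^ 2) := by
    refine (hinit N (2 * M) hN1 (by omega) (2 * L) (by positivity) ?_).trans ?_
    · refine le_trans ?_ hNl
      have h1 : κ * ν = ν / ε + ε * ν := by rw [hκ]; ring
      have h2 : 0 < ε * ν := by positivity
      have h3 : 0 < ν / ε := by positivity
      rw [hL]
      linarith
    · exact mul_le_mul_of_nonneg_left (hΦ _ _ (by omega) (by linarith)) hK'.le
  calc _ ≤ μ.real ({w | w 0 ≠ 0} ∪ {w | w 0 = 0 ∧ ∃ j ≤ 2 * M, w j ∉ box d (2 * L)} ∪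
        ⋃ j ∈ Finset.Icc 1 J, V j) := by
        refine measureReal_mono ?_ (measure_ne_top _ _)
        rintro w ⟨⟨s, t, hs, ht, hst, hosc⟩, hstay⟩
        obtain ⟨j, i, hj, hi1, hi2, hw⟩ := exists_block_of_osc hε hδ hn hs ht hst hosc
        rw [show ε * √n / 2 = 2 * L by rw [hL]; ring] at hw
        rcases Nat.eq_zero_or_pos j with rfl | hj0
        · refine Or.inl ?_
          by_cases h0 : w 0 = 0
          · refine Or.inr ⟨h0, i, hi2, ?_⟩
            simpa [h0, cube_zero] using hw
          · exact Or.inl h0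
        · refine Or.inr ?_
          have hTn : 1 ≤ T * n := one_le_mul_of_one_le_of_one_le hT hn1
          simp only [Set.mem_iUnion]
          refine ⟨j, Finset.mem_Icc.2 ⟨hj0, Nat.le_floor ?_⟩, fun l hl => hstay l ?_, i, hi1, hi2, hw⟩
          · rw [le_div_iff₀ hδ]
            have h1 : (j : ℝ) * (3 * δ * n) ≤ 2 * (T * n) := by
              refine (mul_le_mul_of_nonneg_left hMl (Nat.cast_nonneg j)).trans ?_
              push_cast at hj
              linarith
            have h2 : (j : ℝ) * δ * n ≤ T * n := by linarith
            exact le_of_mul_le_mul_right h2 hn0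
          · have : (l : ℝ) ≤ ((j * M : ℕ) : ℝ) := by exact_mod_cast hl
            linarith
    _ ≤ 0 + K' * (D * δ ^ 2) + ∑ _j ∈ Finset.Icc 1 J, (box d Z).card * (K * (D * δ ^ 2)) := by
        refine (measureReal_union_le _ _).trans (add_le_add ((measureReal_union_le _ _).trans
          (add_le_add (measureReal_ne_zero_start hμ).le hini)) ?_)
        exact (measureReal_biUnion_finset_le _ _).trans (Finset.sum_le_sum hblk)
    _ = K' * D * δ ^ 2 + J * ((box d Z).card * (K * (D * δ ^ 2))) := by
        rw [Finset.sum_const, Nat.card_Icc, Nat.add_sub_cancel, nsmul_eq_mul]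
        ring
    _ ≤ K' * D * δ ^ 2 + T / δ * ((box d Z).card * (K * (D * δ ^ 2))) := by gcongr
    _ = K' * D * δ ^ 2 + T * ((box d Z).card * K) * D * δ := by
        field_simp
    _ ≤ K' * D * √δ + T * ((box d Z).card * K) * D * √δ := by
        have h1 : δ ≤ √δ := Real.le_sqrt_of_sq_le (by nlinarith)
        have h2 : δ ^ 2 ≤ √δ := le_trans (by nlinarith) h1
        gcongr
    _ = _ := by ring

/-- STATEMENT 7 (Lemma 2.7): oscillation bound for `B^{(n)}` on the event that the
walk has not exited `Λ_{√n/ε}`. -/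
theorem statement7 (d : ℕ) (hd : 2 ≤ d) (p q : ℝ)
    (hp : (d : ℝ) / 2 < p) (hq : (d : ℝ) / 2 < q) (hpq : 1 / p + 1 / q < 2 / (d : ℝ))
    (ε T : ℝ) (hε : 0 < ε) (hT : 1 ≤ T)
    (ω : EnvSp d) (hmom : InOmegaPQ d p q ω)
    (μ : Measure (Path d)) (hμ : IsWalkLaw d ω 0 μ) :
    ∃ c : ℝ, 0 < c ∧
      ∀ δ : ℝ, 0 < δ → ∀ n : ℕ, 1 / δ < (n : ℝ) →
        μ {w | (∃ s t : ℝ, s ∈ Set.Icc (0:ℝ) T ∧ t ∈ Set.Icc (0:ℝ) T ∧ |t - s| < δ ∧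
                  ε < ‖BnProc d n w t - BnProc d n w s‖) ∧
               ∀ k : ℕ, (k : ℝ) ≤ 3 * T * n → w k ∈ box d (Real.sqrt n / ε)} ≤
          ENNReal.ofReal (c * Real.sqrt δ) := by
  have := hμ.1
  obtain ⟨A, hA, hblock⟩ := hmom.exists_block_bound hd hp hq hpq hμ
  have hlim : Tendsto (fun B : ℕ => (2 : ℝ) ^ A * (200 / 243) ^ B) atTop (𝓝 (2 ^ A * 0)) :=
    (tendsto_pow_atTop_nhds_zero_of_lt_one (by norm_num) (by norm_num)).const_mul _
  rw [mul_zero] at hlim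
  obtain ⟨B, hB, hAB⟩ := ((hlim.eventually_le_const (by norm_num : (0 : ℝ) < 1 / 2)).and
    (tendsto_natCast_atTop_atTop.eventually_ge_atTop (A + 2))).exists
  obtain ⟨K, hK, hblk⟩ := hblock B
  obtain ⟨K', hK', hinit⟩ := hblk.exists_initial_bound (by omega) hμ hA hB hK
  obtain ⟨c, hc, hosc⟩ := measureReal_osc_le hμ hA hAB hK hK' hblk hinit hε hT
  refine ⟨c + 1, by positivity, fun δ hδ n hn => ?_⟩
  rw [← ofReal_measureReal]
  refine ENNReal.ofReal_le_ofReal ?_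
  rcases le_or_gt δ 1 with hδ1 | hδ1
  · exact (hosc δ hδ hδ1 n hn).trans (by gcongr; linarith)
  · have h1 : 1 ≤ √δ := Real.one_le_sqrt.2 hδ1.le
    exact measureReal_le_one.trans (by nlinarith)

end DetCond
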